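/- Let Ω = Ω_{π/2} be the quarter-plane sector and let φ ∈ C_0^∞(ℝ²) be real-valued. Then for the compact self-adjoint operator A_Ω = A_Ω[φ]: G^{(+)}_{1,1}(A_Ω) = G^{(−)}_{1,1}(A_Ω) = (1/2) G_{1,1}(A_Ω) and g^{(+)}_{1,1}(A_Ω) = g^{(−)}_{1,1}(A_Ω) = (1/2) g_{1,1}(A_Ω). -/

import Mathlib

open MeasureTheory Filter Complex
open scoped ENNReal InnerProductSpace RealInnerProductSpace

noncomputable section

/-- `λ_{k+1}^{(+)}(A)` via the Courant–Fischer min-max principle: for a compact self-adjoint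
operator this gives the `(k+1)`-st positive eigenvalue in non-increasing order counting
multiplicity (and `0` once the positive eigenvalues are exhausted). -/
def eigPlus {H : Type*} [NormedAddCommGroup H] [InnerProductSpace ℂ H]
    (A : H →L[ℂ] H) (k : ℕ) : ℝ :=
  ⨅ V : {V : Submodule ℂ H // Module.rank ℂ V ≤ (k : Cardinal)},
    ⨆ u : {u : H // u ∈ (V : Submodule ℂ H)ᗮ ∧ ‖u‖ = 1},
      (⟪A u.1, u.1⟫_ℂ).re

/-- `λ_{k+1}^{(-)}(A)`, the `(k+1)`-st negative eigenvalue sequence member (absolute value). -/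
def eigMinus {H : Type*} [NormedAddCommGroup H] [InnerProductSpace ℂ H]
    (A : H →L[ℂ] H) (k : ℕ) : ℝ :=
  eigPlus (-A) k

/-- the argument of a complex number, taken in `[0, 2π)` -/
def arg2pi (z : ℂ) : ℝ := if 0 ≤ z.arg then z.arg else z.arg + 2 * Real.pi

/-- the open sector `Ω_θ = {(x,ξ) : 0 < arg (x + iξ) < θ}` in the phase plane -/
def sector (θ : ℝ) : Set (ℝ × ℝ) :=
  {p | 0 < arg2pi (p.1 + p.2 * Complex.I) ∧ arg2pi (p.1 + p.2 * Complex.I) < θ}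

abbrev L2R := MeasureTheory.Lp ℂ 2 (volume : Measure ℝ)

/-- the Weyl quantization integral formula in dimension one -/
def weylIntegral (a : ℝ × ℝ → ℂ) (u : ℝ → ℂ) (x : ℝ) : ℂ :=
  (2 * Real.pi : ℝ)⁻¹ *
    ∫ ξ : ℝ, ∫ y : ℝ,
      Complex.exp (Complex.I * ((x - y) * ξ : ℝ)) * a ((x + y) / 2, ξ) * u y

/-- `T` is the Weyl pseudodifferential operator `Op^w(a)` on `L²(ℝ)` -/
def IsWeylOp (a : ℝ × ℝ → ℂ) (T : L2R →L[ℂ] L2R) : Prop :=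
  ∀ u : SchwartzMap ℝ ℂ, ∀ f : L2R, (⇑f =ᵐ[volume] ⇑u) →
    ⇑(T f) =ᵐ[volume] weylIntegral a ⇑u

/-- the symbol `1_Ω φ` of the operator `A_Ω[φ]` -/
def symbAOm (Ω : Set (ℝ × ℝ)) (φ : ℝ × ℝ → ℝ) : ℝ × ℝ → ℂ :=
  Set.indicator Ω fun τ => (φ τ : ℂ)

/-- approximation numbers = singular values -/
def sVal {H : Type*} [NormedAddCommGroup H] [NormedSpace ℂ H]
    (A : H →L[ℂ] H) (k : ℕ) : ℝ :=
  sInf ((fun F : H →L[ℂ] H => ‖A - F‖) ''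
    {F | Module.rank ℂ (LinearMap.range (F : H →ₗ[ℂ] H)) ≤ (k : Cardinal)})

/-- `f_σ(t) = t / log^σ (t + e^{σ+1})` -/
def fSigma (σ t : ℝ) : ℝ := t / (Real.log (t + Real.exp (σ + 1))) ^ σ

variable {H : Type*} [NormedAddCommGroup H] [InnerProductSpace ℂ H]

/-- `G_{p,σ}(A) = limsup_k s_k(A) f_σ(k)^{1/p}` -/
def Gfun (p σ : ℝ) (A : H →L[ℂ] H) : ℝ :=
  limsup (fun k : ℕ => sVal A k * fSigma σ (k + 1) ^ (1 / p)) atTop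

def gfun (p σ : ℝ) (A : H →L[ℂ] H) : ℝ :=
  liminf (fun k : ℕ => sVal A k * fSigma σ (k + 1) ^ (1 / p)) atTop

def GfunPlus (p σ : ℝ) (A : H →L[ℂ] H) : ℝ :=
  limsup (fun k : ℕ => eigPlus A k * fSigma σ (k + 1) ^ (1 / p)) atTop

def gfunPlus (p σ : ℝ) (A : H →L[ℂ] H) : ℝ :=
  liminf (fun k : ℕ => eigPlus A k * fSigma σ (k + 1) ^ (1 / p)) atTop

def GfunMinus (p σ : ℝ) (A : H →L[ℂ] H) : ℝ := GfunPlus p σ (-A)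

def gfunMinus (p σ : ℝ) (A : H →L[ℂ] H) : ℝ := gfunPlus p σ (-A)

/-- Asymptotic upper bounds of `X` are, after scaling by `r`, asymptotic upper bounds of `Y`. -/
def UpperDom (r : ℝ) (X Y : ℕ → ℝ) : Prop :=
  ∀ c, (∀ᶠ k in atTop, X k ≤ c) → ∀ ε > 0, ∀ᶠ k in atTop, Y k ≤ r * c + ε

/-- Asymptotic lower bounds of `X` are, after scaling by `r`, asymptotic lower bounds of `Y`. -/
def LowerDom (r : ℝ) (X Y : ℕ → ℝ) : Prop :=
  ∀ c, (∀ᶠ k in atTop, c ≤ X k) → ∀ ε > 0, ∀ᶠ k in atTop, r * c - ε ≤ Y k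

theorem sInf_eq_mul_sInf {S S' : Set ℝ} {r : ℝ} (hr : 0 < r)
    (h : ∀ c ∈ S, ∀ ε > 0, r * c + ε ∈ S') (h' : ∀ c ∈ S', ∀ ε > 0, r⁻¹ * c + ε ∈ S) :
    sInf S' = r * sInf S := by
  rcases S.eq_empty_or_nonempty with rfl | hS
  · have : S' = ∅ := by
      by_contra hne
      obtain ⟨c, hc⟩ := Set.nonempty_iff_ne_empty.2 hne
      exact h' c hc 1 one_pos
    simp [this]
  have hS' : S'.Nonempty := by
    obtain ⟨c, hc⟩ := hS
    exact ⟨_, h c hc 1 one_pos⟩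
  by_cases hb : BddBelow S
  · have hb' : BddBelow S' := by
      obtain ⟨m, hm⟩ := hb
      refine ⟨r * (m - 1), fun c hc => ?_⟩
      have := hm (h' c hc 1 one_pos)
      have h2 : m - 1 ≤ r⁻¹ * c := by linarith
      calc r * (m - 1) ≤ r * (r⁻¹ * c) := by gcongr
        _ = c := by field_simp
    apply le_antisymm
    · rw [← div_le_iff₀' hr]
      refine le_csInf hS fun c hc => ?_
      rw [div_le_iff₀' hr]
      refine le_of_forall_pos_le_add fun ε hε => csInf_le hb' (h c hc ε hε)
    · refine le_csInf hS' fun c hc => ?_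
      have : sInf S ≤ r⁻¹ * c :=
        le_of_forall_pos_le_add fun ε hε => csInf_le hb (h' c hc ε hε)
      calc r * sInf S ≤ r * (r⁻¹ * c) := by gcongr
        _ = c := by field_simp
  · have hb' : ¬ BddBelow S' := by
      rintro ⟨m, hm⟩
      refine hb ⟨r⁻¹ * (m - 1), fun c hc => ?_⟩
      have := hm (h c hc 1 one_pos)
      rw [inv_mul_le_iff₀ hr]
      linarith
    rw [Real.sInf_of_not_bddBelow hb, Real.sInf_of_not_bddBelow hb', mul_zero]

theorem limsup_eq_mul_limsup {r : ℝ} (hr : 0 < r) {X Y : ℕ → ℝ}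
    (h : UpperDom r X Y) (h' : UpperDom r⁻¹ Y X) :
    limsup Y atTop = r * limsup X atTop := by
  rw [limsup_eq, limsup_eq]
  exact sInf_eq_mul_sInf hr h h'

theorem liminf_eq_mul_liminf {r : ℝ} (hr : 0 < r) {X Y : ℕ → ℝ}
    (h : LowerDom r X Y) (h' : LowerDom r⁻¹ Y X) :
    liminf Y atTop = r * liminf X atTop := by
  rw [liminf_eq, liminf_eq, ← neg_inj, ← mul_neg, ← Real.sInf_neg, ← Real.sInf_neg]
  refine sInf_eq_mul_sInf hr (fun c hc ε hε => ?_) (fun c hc ε hε => ?_)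
  · filter_upwards [h (-c) hc ε hε] with k hk
    linarith
  · filter_upwards [h' (-c) hc ε hε] with k hk
    linarith

theorem UpperDom.trans {r r' : ℝ} (hr' : 0 < r') {X Y Z : ℕ → ℝ}
    (h : UpperDom r X Y) (h' : UpperDom r' Y Z) : UpperDom (r' * r) X Z := by
  intro c hc ε hε
  filter_upwards [h' _ (h c hc (ε / 2 / r') (by positivity)) (ε / 2) (by positivity)] with k hk
  refine hk.trans_eq ?_
  field_simp
  ring

theorem LowerDom.trans {r r' : ℝ} (hr' : 0 < r') {X Y Z : ℕ → ℝ}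
    (h : LowerDom r X Y) (h' : LowerDom r' Y Z) : LowerDom (r' * r) X Z := by
  intro c hc ε hε
  filter_upwards [h' _ (h c hc (ε / 2 / r') (by positivity)) (ε / 2) (by positivity)] with k hk
  refine hk.trans_eq' ?_
  field_simp
  ring

theorem UpperDom.of_le {r : ℝ} {X Y ρ η : ℕ → ℝ} {n : ℕ → ℕ} (hρ : Tendsto ρ atTop (nhds r))
    (hη : Tendsto η atTop (nhds 0)) (hn : Tendsto n atTop atTop) (hρ0 : ∀ k, 0 ≤ ρ k)
    (h : ∀ k, Y k ≤ ρ k * X (n k) + η k) : UpperDom r X Y := by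
  intro c hc ε hε
  have h1 : Tendsto (fun k => ρ k * c + η k) atTop (nhds (r * c)) := by
    simpa using (hρ.mul_const c).add hη
  filter_upwards [hn.eventually hc, h1.eventually_le_const (show r * c < r * c + ε by linarith)]
    with k hk hk'
  have := mul_le_mul_of_nonneg_left hk (hρ0 k)
  linarith [h k]

theorem LowerDom.of_le {r : ℝ} {X Y ρ η : ℕ → ℝ} {n : ℕ → ℕ} (hρ : Tendsto ρ atTop (nhds r))
    (hη : Tendsto η atTop (nhds 0)) (hn : Tendsto n atTop atTop) (hρ0 : ∀ k, 0 ≤ ρ k)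
    (h : ∀ k, ρ k * X (n k) - η k ≤ Y k) : LowerDom r X Y := by
  intro c hc ε hε
  have h1 : Tendsto (fun k => ρ k * c - η k) atTop (nhds (r * c)) := by
    simpa using (hρ.mul_const c).sub hη
  filter_upwards [hn.eventually hc, h1.eventually_const_le (show r * c - ε < r * c by linarith)]
    with k hk hk'
  have := mul_le_mul_of_nonneg_left hk (hρ0 k)
  linarith [h k]

/-- The logarithmic factor in the weight `f₁`. -/
def logWeight (k : ℕ) : ℝ := Real.log ((k : ℝ) + 1 + Real.exp 2)

/-- The weight `f₁(k + 1)`. -/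
def weight (k : ℕ) : ℝ := ((k : ℝ) + 1) / logWeight k

theorem fSigma_eq_weight (k : ℕ) : fSigma 1 ((k : ℝ) + 1) ^ (1 / (1 : ℝ)) = weight k := by
  have : (1 : ℝ) + 1 = 2 := by norm_num
  simp [fSigma, weight, logWeight, this]

theorem two_le_logWeight (k : ℕ) : 2 ≤ logWeight k := by
  rw [logWeight, Real.le_log_iff_exp_le (by positivity)]
  have : (0 : ℝ) ≤ k := k.cast_nonneg
  linarith

theorem logWeight_pos (k : ℕ) : 0 < logWeight k := by linarith [two_le_logWeight k]

theorem logWeight_mono : Monotone logWeight := by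
  intro i j hij
  have : (i : ℝ) ≤ j := by exact_mod_cast hij
  unfold logWeight
  gcongr

theorem weight_pos (k : ℕ) : 0 < weight k := by
  have := logWeight_pos k
  unfold weight
  positivity

theorem logWeight_two_mul_add_one_le (k : ℕ) :
    logWeight (2 * k + 1) ≤ logWeight k + Real.log 2 := by
  unfold logWeight
  rw [← Real.log_mul (by positivity) (by norm_num)]
  apply Real.log_le_log (by positivity)
  push_cast
  linarith [Real.exp_pos 2]

theorem tendsto_logWeight : Tendsto logWeight atTop atTop := by
  unfold logWeight
  refine Real.tendsto_log_atTop.comp ?_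
  refine tendsto_atTop_add_const_right _ _ (tendsto_atTop_add_const_right _ _ ?_)
  exact tendsto_natCast_atTop_atTop

theorem tendsto_half : Tendsto (fun k : ℕ => k / 2) atTop atTop :=
  Nat.tendsto_div_const_atTop (by norm_num)

section Shift

/-- The reciprocal of the relative shift used to absorb a perturbation of size `O(1/k)`. -/
def shiftDen (k : ℕ) : ℕ := ⌈Real.sqrt (logWeight k)⌉₊

theorem two_le_shiftDen (k : ℕ) : 2 ≤ shiftDen k := by
  unfold shiftDen
  have h1 : (1 : ℝ) < Real.sqrt (logWeight k) := by
    rw [Real.lt_sqrt (by norm_num)]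
    linarith [two_le_logWeight k]
  have : 1 < ⌈Real.sqrt (logWeight k)⌉₊ := by
    rw [Nat.lt_ceil]; exact_mod_cast h1
  omega

theorem tendsto_shiftDen : Tendsto (fun k => (shiftDen k : ℝ)) atTop atTop :=
  tendsto_atTop_mono (fun _ => Nat.le_ceil _) (Real.tendsto_sqrt_atTop.comp tendsto_logWeight)

theorem tendsto_shiftDen_div : Tendsto (fun k => (shiftDen k : ℝ) / logWeight k) atTop (nhds 0) := by
  have h1 : Tendsto (fun k => 2 / Real.sqrt (logWeight k)) atTop (nhds 0) :=
    (Real.tendsto_sqrt_atTop.comp tendsto_logWeight).const_div_atTop 2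
  refine squeeze_zero (fun k => div_nonneg (Nat.cast_nonneg _) (logWeight_pos k).le)
    (fun k => ?_) h1
  have hl := two_le_logWeight k
  have hs : 0 < Real.sqrt (logWeight k) := Real.sqrt_pos.2 (logWeight_pos k)
  have h2 : 1 ≤ Real.sqrt (logWeight k) := by
    rw [Real.one_le_sqrt]; linarith
  rw [div_le_div_iff₀ (logWeight_pos k) hs]
  have h3 : (shiftDen k : ℝ) ≤ Real.sqrt (logWeight k) + 1 := (Nat.ceil_lt_add_one hs.le).le
  have h4 := Real.mul_self_sqrt (logWeight_pos k).le
  nlinarith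

theorem weight_div_shift_le {C : ℝ} (hC : 0 ≤ C) (k : ℕ) :
    C / (((k / shiftDen k : ℕ) : ℝ) + 1) * weight k ≤ C * ((shiftDen k : ℝ) / logWeight k) := by
  have h0 : 0 < shiftDen k := by linarith [two_le_shiftDen k]
  have h1 : k + 1 ≤ shiftDen k * (k / shiftDen k + 1) := by
    have := Nat.lt_mul_div_succ k h0
    omega
  have h2 : (k : ℝ) + 1 ≤ shiftDen k * (((k / shiftDen k : ℕ) : ℝ) + 1) := by exact_mod_cast h1
  have hl := logWeight_pos k
  unfold weight
  rw [div_mul_div_comm, ← mul_div_assoc, div_le_div_iff₀ (by positivity) hl]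
  have : C * ((k : ℝ) + 1) ≤ C * (shiftDen k * (((k / shiftDen k : ℕ) : ℝ) + 1)) := by gcongr
  nlinarith

theorem upperDom_of_shift {x y : ℕ → ℝ} {C : ℝ} (hC : 0 ≤ C) (hx : ∀ k, 0 ≤ x k)
    (h : ∀ j k, y (j + k) ≤ x j + C / ((k : ℝ) + 1)) :
    UpperDom 1 (fun k => x k * weight k) (fun k => y k * weight k) := by
  refine UpperDom.of_le (ρ := fun k => (shiftDen k : ℝ) / (shiftDen k - 1))
    (η := fun k => C * ((shiftDen k : ℝ) / logWeight k)) (n := fun k => k - k / shiftDen k)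
    ?_ ?_ ?_ ?_ ?_
  · have h1 : Tendsto (fun k => 1 + 1 / ((shiftDen k : ℝ) - 1)) atTop (nhds (1 + 0)) :=
      tendsto_const_nhds.add
        ((tendsto_atTop_add_const_right _ (-1) tendsto_shiftDen).const_div_atTop 1)
    rw [add_zero] at h1
    refine h1.congr fun k => ?_
    have : (2 : ℝ) ≤ shiftDen k := by exact_mod_cast two_le_shiftDen k
    have : (shiftDen k : ℝ) - 1 ≠ 0 := by linarith
    field_simp
    ring
  · simpa using tendsto_shiftDen_div.const_mul C
  · refine tendsto_atTop_mono (fun k => ?_) tendsto_half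
    have : k / shiftDen k ≤ k / 2 := Nat.div_le_div_left (two_le_shiftDen k) (by norm_num)
    omega
  · intro k
    have : (2 : ℝ) ≤ shiftDen k := by exact_mod_cast two_le_shiftDen k
    exact div_nonneg (by linarith) (by linarith)
  · intro k
    set m := shiftDen k
    set j := k / m with hj
    have hm : 2 ≤ m := two_le_shiftDen k
    have hm' : (2 : ℝ) ≤ m := by exact_mod_cast hm
    have hjk : j ≤ k := Nat.div_le_self _ _
    have hkj : k - j + j = k := Nat.sub_add_cancel hjk
    have h1 := h (k - j) j
    rw [hkj] at h1
    have h2 : weight k ≤ (m : ℝ) / (m - 1) * weight (k - j) := by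
      have hl : logWeight (k - j) ≤ logWeight k := logWeight_mono (Nat.sub_le _ _)
      have hlp := logWeight_pos (k - j)
      have hc : ((k - j : ℕ) : ℝ) = (k : ℝ) - j := by push_cast [hjk]; ring
      have h3 : (m : ℝ) * j ≤ k := by exact_mod_cast Nat.mul_div_le k m
      have h4 : (j : ℝ) ≤ k := by exact_mod_cast hjk
      calc weight k ≤ ((k : ℝ) + 1) / logWeight (k - j) := by unfold weight; gcongr
        _ ≤ ((m : ℝ) / (m - 1) * (k - j + 1)) / logWeight (k - j) := by
            gcongr
            rw [div_mul_eq_mul_div, le_div_iff₀ (by linarith)]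
            nlinarith
        _ = _ := by unfold weight; rw [hc]; ring
    have h5 := weight_div_shift_le hC k
    have h6 := mul_le_mul_of_nonneg_right h1 (weight_pos k).le
    have h7 := mul_le_mul_of_nonneg_left h2 (hx (k - j))
    rw [add_mul] at h6
    have : x (k - j) * ((m : ℝ) / (m - 1) * weight (k - j)) =
      (m : ℝ) / (m - 1) * (x (k - j) * weight (k - j)) := by ring
    linarith

theorem lowerDom_of_shift {x y : ℕ → ℝ} {C : ℝ} (hC : 0 ≤ C) (hy : ∀ k, 0 ≤ y k)
    (h : ∀ j k, y (j + k) ≤ x j + C / ((k : ℝ) + 1)) :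
    LowerDom 1 (fun k => y k * weight k) (fun k => x k * weight k) := by
  refine LowerDom.of_le (ρ := fun k => (shiftDen k : ℝ) / (shiftDen k + 1))
    (η := fun k => C * ((shiftDen k : ℝ) / logWeight k)) (n := fun k => k + k / shiftDen k)
    ?_ ?_ ?_ ?_ ?_
  · have h1 : Tendsto (fun k => 1 - 1 / ((shiftDen k : ℝ) + 1)) atTop (nhds (1 - 0)) :=
      tendsto_const_nhds.sub
        ((tendsto_atTop_add_const_right _ 1 tendsto_shiftDen).const_div_atTop 1)
    rw [sub_zero] at h1
    refine h1.congr fun k => ?_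
    field_simp
    ring
  · simpa using tendsto_shiftDen_div.const_mul C
  · exact tendsto_atTop_mono (fun k => Nat.le_add_right _ _) tendsto_id
  · intro k
    positivity
  · intro k
    set m := shiftDen k
    set j := k / m with hj
    have h1 := h k j
    have h2 : (m : ℝ) / (m + 1) * weight (k + j) ≤ weight k := by
      have hl : logWeight k ≤ logWeight (k + j) := logWeight_mono (Nat.le_add_right _ _)
      have hlp := logWeight_pos k
      have h3 : (m : ℝ) * j ≤ k := by exact_mod_cast Nat.mul_div_le k m
      calc (m : ℝ) / (m + 1) * weight (k + j)
          = ((m : ℝ) / (m + 1) * (k + j + 1)) / logWeight (k + j) := by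
            unfold weight; push_cast; ring
        _ ≤ ((m : ℝ) / (m + 1) * (k + j + 1)) / logWeight k := by gcongr
        _ ≤ _ := by
            unfold weight
            gcongr
            rw [div_mul_eq_mul_div, div_le_iff₀ (by positivity)]
            nlinarith
    have h5 := weight_div_shift_le hC k
    have h6 := mul_le_mul_of_nonneg_right h1 (weight_pos k).le
    have h7 := mul_le_mul_of_nonneg_left h2 (hy (k + j))
    rw [add_mul] at h6
    have : y (k + j) * ((m : ℝ) / (m + 1) * weight (k + j)) =
      (m : ℝ) / (m + 1) * (y (k + j) * weight (k + j)) := by ring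
    linarith

end Shift

section Doubling

variable {s x : ℕ → ℝ}

theorem tendsto_logWeight_ratio :
    Tendsto (fun k => (logWeight k + Real.log 2) / logWeight k) atTop (nhds 1) := by
  have h1 : Tendsto (fun k => 1 + Real.log 2 / logWeight k) atTop (nhds (1 + 0)) :=
    tendsto_const_nhds.add (tendsto_logWeight.const_div_atTop _)
  rw [add_zero] at h1
  refine h1.congr fun k => ?_
  have := (logWeight_pos k).ne'
  field_simp

theorem upperDom_two (hs : Antitone s) (hx : ∀ k, 0 ≤ x k) (h : ∀ k, s (2 * k) ≤ x k) :
    UpperDom 2 (fun k => x k * weight k) (fun k => s k * weight k) := by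
  refine UpperDom.of_le (ρ := fun _ => 2) (η := fun _ => 0) (n := fun k => k / 2)
    tendsto_const_nhds tendsto_const_nhds tendsto_half (fun _ => by norm_num) fun k => ?_
  have h1 : s k ≤ x (k / 2) := (hs (Nat.mul_div_le k 2)).trans (h _)
  have h2 : weight k ≤ 2 * weight (k / 2) := by
    have hl : logWeight (k / 2) ≤ logWeight k := logWeight_mono (Nat.div_le_self _ _)
    have hlp := logWeight_pos (k / 2)
    have h3 : (k : ℝ) + 1 ≤ 2 * (((k / 2 : ℕ) : ℝ) + 1) := by
      have : k + 1 ≤ 2 * (k / 2 + 1) := by omega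
      exact_mod_cast this
    unfold weight
    rw [← mul_div_assoc]
    gcongr
  calc s k * weight k ≤ x (k / 2) * (2 * weight (k / 2)) :=
        mul_le_mul h1 h2 (weight_pos k).le (hx _)
    _ = _ := by ring

theorem upperDom_half (hs : ∀ k, 0 ≤ s k) (h : ∀ k, x k ≤ s (2 * k + 1)) :
    UpperDom (1 / 2) (fun k => s k * weight k) (fun k => x k * weight k) := by
  refine UpperDom.of_le (ρ := fun k => 1 / 2 * ((logWeight k + Real.log 2) / logWeight k))
    (η := fun _ => 0) (n := fun k => 2 * k + 1)
    (by simpa using tendsto_logWeight_ratio.const_mul (1 / 2 : ℝ)) tendsto_const_nhds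
    (tendsto_atTop_mono (fun k => show k ≤ _ by omega) tendsto_id) (fun k => ?_) fun k => ?_
  · have := logWeight_pos k
    have := Real.log_pos one_lt_two
    positivity
  · have h1 := logWeight_pos k
    have h2 := logWeight_pos (2 * k + 1)
    have h3 := logWeight_two_mul_add_one_le k
    have h4 : weight k ≤
        1 / 2 * ((logWeight k + Real.log 2) / logWeight k) * weight (2 * k + 1) := by
      calc weight k = 1 / 2 * (logWeight (2 * k + 1) / logWeight k) * weight (2 * k + 1) := by
            unfold weight; push_cast; field_simp; ring
        _ ≤ _ := by
            have := weight_pos (2 * k + 1)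
            gcongr
    calc x k * weight k ≤ s (2 * k + 1) *
          (1 / 2 * ((logWeight k + Real.log 2) / logWeight k) * weight (2 * k + 1)) :=
          mul_le_mul (h k) h4 (weight_pos k).le (hs _)
      _ = _ := by ring

theorem lowerDom_two (hs : Antitone s) (hx : ∀ k, 0 ≤ x k) (h : ∀ k, x k ≤ s (2 * k + 1)) :
    LowerDom 2 (fun k => x k * weight k) (fun k => s k * weight k) := by
  have hlim : Tendsto (fun i : ℕ => (2 * (i : ℝ) + 1) / (i + 1) *
      ((logWeight i + Real.log 2) / logWeight i)⁻¹) atTop (nhds 2) := by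
    have h1 : Tendsto (fun i : ℕ => 2 - 1 / ((i : ℝ) + 1)) atTop (nhds (2 - 0)) :=
      tendsto_const_nhds.sub tendsto_one_div_add_atTop_nhds_zero_nat
    have h2 := h1.mul (tendsto_logWeight_ratio.inv₀ one_ne_zero)
    simp only [sub_zero, inv_one, mul_one] at h2
    refine h2.congr fun k => ?_
    congr 1
    field_simp
    ring
  refine LowerDom.of_le (η := fun _ => 0) (n := fun k => k / 2)
    (hlim.comp tendsto_half) tendsto_const_nhds tendsto_half (fun k => ?_) fun k => ?_
  · have := logWeight_pos (k / 2)
    have := Real.log_pos one_lt_two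
    dsimp only [Function.comp]
    positivity
  · dsimp only [Function.comp]
    set i := k / 2 with hi
    have h1 := logWeight_pos i
    have hk1 : k ≤ 2 * i + 1 := by omega
    have h3 := (logWeight_mono hk1).trans (logWeight_two_mul_add_one_le i)
    have h2 := logWeight_pos k
    have h5 : 2 * (i : ℝ) ≤ k := by exact_mod_cast Nat.mul_div_le k 2
    have h4 : (2 * (i : ℝ) + 1) / (i + 1) * ((logWeight i + Real.log 2) / logWeight i)⁻¹ *
        weight i ≤ weight k := by
      calc _ = (2 * (i : ℝ) + 1) / (logWeight i + Real.log 2) := by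
            unfold weight
            have : (0 : ℝ) < logWeight i + Real.log 2 := by linarith
            field_simp
        _ ≤ _ := by unfold weight; gcongr
    have h6 : x i ≤ s k := (h i).trans (hs hk1)
    calc _ = x i * ((2 * (i : ℝ) + 1) / (i + 1) *
            ((logWeight i + Real.log 2) / logWeight i)⁻¹ * weight i) := by ring
      _ ≤ x i * weight k := mul_le_mul_of_nonneg_left h4 (hx i)
      _ ≤ _ := mul_le_mul_of_nonneg_right h6 (weight_pos k).le

theorem lowerDom_half (hs : ∀ k, 0 ≤ s k) (h : ∀ k, s (2 * k) ≤ x k) :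
    LowerDom (1 / 2) (fun k => s k * weight k) (fun k => x k * weight k) := by
  refine LowerDom.of_le (ρ := fun _ => 1 / 2) (η := fun _ => 0) (n := fun k => 2 * k)
    tendsto_const_nhds tendsto_const_nhds
    (tendsto_atTop_mono (fun k => show k ≤ _ by omega) tendsto_id) (fun _ => by norm_num) fun k => ?_
  have h2 : 1 / 2 * weight (2 * k) ≤ weight k := by
    have hl : logWeight k ≤ logWeight (2 * k) := logWeight_mono (by omega)
    have hlp := logWeight_pos k
    unfold weight
    rw [← mul_div_assoc]
    gcongr
    push_cast
    linarith
  calc _ = s (2 * k) * (1 / 2 * weight (2 * k)) := by ring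
    _ ≤ s (2 * k) * weight k := mul_le_mul_of_nonneg_left h2 (hs _)
    _ ≤ _ := mul_le_mul_of_nonneg_right (h k) (weight_pos k).le

end Doubling

/-- If two sequences agree up to index shifts and `O(1/k)` errors and interlace `s` as positive
and negative eigenvalues do singular values, then their weighted limits are half those of `s`. -/
theorem weighted_limits_eq {a b s : ℕ → ℝ} {C : ℝ} (hC : 0 ≤ C)
    (ha : ∀ k, 0 ≤ a k) (hb : ∀ k, 0 ≤ b k) (hs0 : ∀ k, 0 ≤ s k) (hs : Antitone s)
    (haa : Antitone a)
    (hab : ∀ j k, a (j + k) ≤ b j + C / ((k : ℝ) + 1))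
    (hbc : ∀ j k, b (j + k) ≤ a j + C / ((k : ℝ) + 1))
    (hmax : ∀ k, s (2 * k) ≤ max (a k) (b k)) (hmin : ∀ k, min (a k) (b k) ≤ s (2 * k + 1)) :
    limsup (fun k => a k * weight k) atTop = limsup (fun k => b k * weight k) atTop ∧
    limsup (fun k => a k * weight k) atTop = 1 / 2 * limsup (fun k => s k * weight k) atTop ∧
    liminf (fun k => a k * weight k) atTop = liminf (fun k => b k * weight k) atTop ∧
    liminf (fun k => a k * weight k) atTop = 1 / 2 * liminf (fun k => s k * weight k) atTop := by
  have hC' : ∀ k : ℕ, 0 ≤ C / ((k : ℝ) + 1) := fun k => by positivity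
  have haM : ∀ j k, max (a (j + k)) (b (j + k)) ≤ a j + C / ((k : ℝ) + 1) := fun j k =>
    max_le ((haa (Nat.le_add_right j k)).trans (by linarith [hC' k])) (hbc j k)
  have hpa : ∀ j k, a (j + k) ≤ min (a j) (b j) + C / ((k : ℝ) + 1) := fun j k => by
    rw [← min_add_add_right]
    exact le_min ((haa (Nat.le_add_right j k)).trans (by linarith [hC' k])) (hab j k)
  have hM : ∀ k, 0 ≤ max (a k) (b k) := fun k => le_max_of_le_left (ha k)
  have hp : ∀ k, 0 ≤ min (a k) (b k) := fun k => le_min (ha k) (hb k)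
  refine ⟨?_, ?_, ?_, ?_⟩
  · simpa using limsup_eq_mul_limsup one_pos (upperDom_of_shift hC hb hab)
      (by simpa using upperDom_of_shift hC ha hbc)
  · refine limsup_eq_mul_limsup (by norm_num) ?_ ?_
    · simpa using (upperDom_half hs0 hmin).trans one_pos (upperDom_of_shift hC hp hpa)
    · simpa using (upperDom_of_shift hC ha haM).trans two_pos (upperDom_two hs hM hmax)
  · simpa using liminf_eq_mul_liminf one_pos (lowerDom_of_shift hC hb hbc)
      (by simpa using lowerDom_of_shift hC ha hab)
  · refine liminf_eq_mul_liminf (by norm_num) ?_ ?_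
    · simpa using (lowerDom_half hs0 hmax).trans one_pos (lowerDom_of_shift hC hM haM)
    · simpa using (lowerDom_of_shift hC ha hpa).trans two_pos (lowerDom_two hs hp hmin)

section Abstract

variable {E : Type*} [NormedAddCommGroup E] [InnerProductSpace ℂ E]

theorem abs_re_inner_le_norm (A : E →L[ℂ] E) {u : E} (hu : ‖u‖ = 1) :
    |(⟪A u, u⟫_ℂ).re| ≤ ‖A‖ := by
  calc |(⟪A u, u⟫_ℂ).re| ≤ ‖⟪A u, u⟫_ℂ‖ := Complex.abs_re_le_norm _
    _ ≤ ‖A u‖ * ‖u‖ := norm_inner_le_norm _ _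
    _ ≤ ‖A‖ := by simpa [hu] using A.le_opNorm u

theorem finiteDimensional_of_rank_le {V : Submodule ℂ E} {k : ℕ}
    (hV : Module.rank ℂ V ≤ (k : Cardinal)) : FiniteDimensional ℂ V :=
  Module.rank_lt_aleph0_iff.1 (hV.trans_lt (Cardinal.natCast_lt_aleph0))

theorem exists_unit_mem_orthogonal (hE : ¬ FiniteDimensional ℂ E) {V : Submodule ℂ E} {k : ℕ}
    (hV : Module.rank ℂ V ≤ (k : Cardinal)) : ∃ u ∈ Vᗮ, ‖u‖ = 1 := by
  have := finiteDimensional_of_rank_le hV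
  have h1 : Vᗮ ≠ ⊥ := by
    rw [Ne, Submodule.orthogonal_eq_bot_iff]
    rintro rfl
    exact hE (Module.Finite.equiv Submodule.topEquiv)
  obtain ⟨v, hv, hv0⟩ := Submodule.exists_mem_ne_zero_of_ne_bot h1
  refine ⟨((‖v‖ : ℂ)⁻¹) • v, Submodule.smul_mem _ _ hv, ?_⟩
  have : ‖v‖ ≠ 0 := norm_ne_zero_iff.2 hv0
  rw [norm_smul, norm_inv, Complex.norm_real, norm_norm, inv_mul_cancel₀ this]

theorem bddAbove_quadratic (A : E →L[ℂ] E) (V : Submodule ℂ E) :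
    BddAbove (Set.range fun u : {u : E // u ∈ Vᗮ ∧ ‖u‖ = 1} => (⟪A u.1, u.1⟫_ℂ).re) := by
  refine ⟨‖A‖, ?_⟩
  rintro _ ⟨u, rfl⟩
  exact (le_abs_self _).trans (abs_re_inner_le_norm A u.2.2)

theorem bddBelow_minmax (A : E →L[ℂ] E) (k : ℕ) :
    BddBelow (Set.range fun V : {V : Submodule ℂ E // Module.rank ℂ V ≤ (k : Cardinal)} =>
      ⨆ u : {u : E // u ∈ (V : Submodule ℂ E)ᗮ ∧ ‖u‖ = 1}, (⟪A u.1, u.1⟫_ℂ).re) := by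
  refine ⟨-‖A‖, ?_⟩
  rintro _ ⟨V, rfl⟩
  dsimp only
  rcases isEmpty_or_nonempty {u : E // u ∈ (V : Submodule ℂ E)ᗮ ∧ ‖u‖ = 1} with h | ⟨⟨u⟩⟩
  · rw [Real.iSup_of_isEmpty]
    exact neg_nonpos.2 (norm_nonneg _)
  · refine le_trans ?_ (le_ciSup (bddAbove_quadratic A V) u)
    exact (abs_le.1 (abs_re_inner_le_norm A u.2.2)).1

theorem eigPlus_le (hE : ¬ FiniteDimensional ℂ E) (A : E →L[ℂ] E) {k : ℕ} {V : Submodule ℂ E}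
    (hV : Module.rank ℂ V ≤ (k : Cardinal)) {c : ℝ}
    (h : ∀ u ∈ Vᗮ, ‖u‖ = 1 → (⟪A u, u⟫_ℂ).re ≤ c) : eigPlus A k ≤ c := by
  refine (ciInf_le (bddBelow_minmax A k) ⟨V, hV⟩).trans ?_
  obtain ⟨u, hu, hu1⟩ := exists_unit_mem_orthogonal hE hV
  have : Nonempty {u : E // u ∈ Vᗮ ∧ ‖u‖ = 1} := ⟨⟨u, hu, hu1⟩⟩
  exact ciSup_le fun u => h u.1 u.2.1 u.2.2

theorem exists_of_eigPlus_lt (A : E →L[ℂ] E) {k : ℕ} {c : ℝ} (hc : eigPlus A k < c) :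
    ∃ V : Submodule ℂ E, Module.rank ℂ V ≤ (k : Cardinal) ∧
      ∀ u ∈ Vᗮ, ‖u‖ = 1 → (⟪A u, u⟫_ℂ).re ≤ c := by
  have : Nonempty {V : Submodule ℂ E // Module.rank ℂ V ≤ (k : Cardinal)} := ⟨⟨⊥, by simp⟩⟩
  obtain ⟨V, hV⟩ := exists_lt_of_ciInf_lt hc
  exact ⟨V.1, V.2, fun u hu hu1 =>
    (le_ciSup (bddAbove_quadratic A V) ⟨u, hu, hu1⟩).trans hV.le⟩

theorem eigPlus_antitone (hE : ¬ FiniteDimensional ℂ E) (A : E →L[ℂ] E) :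
    Antitone (eigPlus A) := by
  intro j k hjk
  refine le_of_forall_gt_imp_ge_of_dense fun c hc => ?_
  obtain ⟨V, hV, h⟩ := exists_of_eigPlus_lt A hc
  exact eigPlus_le hE A (hV.trans (by exact_mod_cast hjk)) h

theorem eigPlus_add_le (hE : ¬ FiniteDimensional ℂ E) (A B : E →L[ℂ] E) (j k : ℕ) :
    eigPlus (A + B) (j + k) ≤ eigPlus A j + eigPlus B k := by
  refine le_of_forall_pos_le_add fun ε hε => ?_
  obtain ⟨V, hV, h⟩ := exists_of_eigPlus_lt A (show eigPlus A j < eigPlus A j + ε / 2 by linarith)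
  obtain ⟨W, hW, h'⟩ := exists_of_eigPlus_lt B (show eigPlus B k < eigPlus B k + ε / 2 by linarith)
  have hr : Module.rank ℂ (V ⊔ W : Submodule ℂ E) ≤ ((j + k : ℕ) : Cardinal) := by
    push_cast
    exact (Submodule.rank_add_le_rank_add_rank V W).trans (add_le_add hV hW)
  refine eigPlus_le hE _ hr fun u hu hu1 => ?_
  have h1 := h u (Submodule.orthogonal_le le_sup_left hu) hu1
  have h2 := h' u (Submodule.orthogonal_le le_sup_right hu) hu1
  rw [add_apply, inner_add_left, Complex.add_re]
  linarith

theorem rank_ker_orthogonal_le [CompleteSpace E] (F : E →L[ℂ] E) {k : ℕ}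
    (hF : Module.rank ℂ (LinearMap.range (F : E →ₗ[ℂ] E)) ≤ (k : Cardinal)) :
    Module.rank ℂ (LinearMap.ker (F : E →ₗ[ℂ] E))ᗮ ≤ (k : Cardinal) := by
  refine le_trans ?_ hF
  refine LinearMap.rank_le_of_injective
    ((F : E →ₗ[ℂ] E).rangeRestrict.domRestrict (LinearMap.ker (F : E →ₗ[ℂ] E))ᗮ) ?_
  rw [injective_iff_map_eq_zero]
  intro x hx
  have h1 : (x : E) ∈ LinearMap.ker (F : E →ₗ[ℂ] E) := by
    have := congrArg Subtype.val hx
    simpa using this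
  have h2 : ⟪(x : E), x⟫_ℂ = 0 := x.2 _ h1
  exact Subtype.ext (inner_self_eq_zero.1 h2)

theorem sVal_le (A F : E →L[ℂ] E) {k : ℕ}
    (hF : Module.rank ℂ (LinearMap.range (F : E →ₗ[ℂ] E)) ≤ (k : Cardinal)) :
    sVal A k ≤ ‖A - F‖ :=
  csInf_le ⟨0, by rintro _ ⟨F, -, rfl⟩; exact norm_nonneg _⟩ ⟨F, hF, rfl⟩

theorem sVal_nonneg (A : E →L[ℂ] E) (k : ℕ) : 0 ≤ sVal A k :=
  Real.sInf_nonneg (by rintro _ ⟨F, -, rfl⟩; exact norm_nonneg _)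

theorem le_sVal (A : E →L[ℂ] E) {k : ℕ} {c : ℝ}
    (h : ∀ F : E →L[ℂ] E,
      Module.rank ℂ (LinearMap.range (F : E →ₗ[ℂ] E)) ≤ (k : Cardinal) → c ≤ ‖A - F‖) :
    c ≤ sVal A k := by
  refine le_csInf ⟨_, 0, ?_, rfl⟩ ?_
  · simp
  · rintro _ ⟨F, hF, rfl⟩
    exact h F hF

theorem sVal_antitone (A : E →L[ℂ] E) : Antitone (sVal A) := fun j k hjk =>
  le_sVal A fun F hF => sVal_le A F (hF.trans (by exact_mod_cast hjk))

theorem sVal_le_norm (A : E →L[ℂ] E) (k : ℕ) : sVal A k ≤ ‖A‖ := by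
  simpa using sVal_le A 0 (k := k) (by simp)

theorem sVal_le_add_norm (A B : E →L[ℂ] E) (k : ℕ) : sVal A k ≤ sVal B k + ‖A - B‖ := by
  rw [← sub_le_iff_le_add]
  refine le_sVal B fun F hF => ?_
  rw [sub_le_iff_le_add]
  refine (sVal_le A F hF).trans ?_
  calc ‖A - F‖ = ‖(B - F) + (A - B)‖ := by congr 1; abel
    _ ≤ _ := norm_add_le _ _

theorem sVal_neg (A : E →L[ℂ] E) (k : ℕ) : sVal (-A) k = sVal A k := by
  have key : ∀ B : E →L[ℂ] E, sVal (-B) k ≤ sVal B k := by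
    intro B
    refine le_sVal B fun F hF => ?_
    have : ‖B - F‖ = ‖-B - -F‖ := by rw [← norm_neg]; congr 1; abel
    rw [this]
    refine sVal_le _ _ ?_
    have : LinearMap.range ((-F : E →L[ℂ] E) : E →ₗ[ℂ] E) =
        LinearMap.range (F : E →ₗ[ℂ] E) := by
      rw [ContinuousLinearMap.toLinearMap_neg, LinearMap.range_neg]
    rwa [this]
  refine le_antisymm (key A) ?_
  simpa using key (-A)

theorem eigPlus_le_sVal [CompleteSpace E] (hE : ¬ FiniteDimensional ℂ E) (A : E →L[ℂ] E)
    (k : ℕ) : eigPlus A k ≤ sVal A k := by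
  refine le_sVal A fun F hF => ?_
  refine eigPlus_le hE A (rank_ker_orthogonal_le F hF) fun u hu hu1 => ?_
  have h1 : u ∈ LinearMap.ker (F : E →ₗ[ℂ] E) := by
    have hc : IsClosed ((LinearMap.ker (F : E →ₗ[ℂ] E) : Submodule ℂ E) : Set E) :=
      F.isClosed_ker
    have : CompleteSpace (LinearMap.ker (F : E →ₗ[ℂ] E)) := hc.completeSpace_coe
    rwa [Submodule.orthogonal_orthogonal] at hu
  have h2 : F u = 0 := h1
  have := (abs_le.1 (abs_re_inner_le_norm (A - F) hu1)).2
  simpa [h2] using this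

theorem eigPlus_le_add_norm [CompleteSpace E] (hE : ¬ FiniteDimensional ℂ E)
    (A B : E →L[ℂ] E) (k : ℕ) : eigPlus A k ≤ eigPlus B k + ‖A - B‖ := by
  have h1 := eigPlus_add_le hE B (A - B) k 0
  have h2 := (eigPlus_le_sVal hE (A - B) 0).trans (sVal_le_norm _ _)
  rw [add_sub_cancel, add_zero] at h1
  linarith

theorem eigPlus_nonneg [CompleteSpace E] (hE : ¬ FiniteDimensional ℂ E) {A : E →L[ℂ] E}
    (hA : ∀ ε > 0, ∃ n, sVal A n < ε) (k : ℕ) : 0 ≤ eigPlus A k := by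
  refine le_of_forall_pos_le_add fun ε hε => ?_
  obtain ⟨n, hn⟩ := hA ε hε
  have h1 := eigPlus_add_le hE A (-A) k n
  have h2 := eigPlus_le_sVal hE (-A) n
  rw [sVal_neg] at h2
  have h3 : 0 ≤ eigPlus (A + -A) (k + n) := by
    refine Real.iInf_nonneg fun V => Real.iSup_nonneg fun u => ?_
    simp
  linarith

theorem rank_span_image_le {ι : Type*} (e : ι → E) (S : Finset ι) :
    Module.rank ℂ (Submodule.span ℂ (e '' (S : Set ι))) ≤ (S.card : Cardinal) := by
  classical
  rw [← Finset.coe_image]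
  refine (rank_span_finset_le _).trans ?_
  exact_mod_cast Finset.card_image_le

section Diagonal

variable {ι : Type*} [Fintype ι] {e : ι → E} {μ : ι → ℝ} {F : E →L[ℂ] E}

theorem re_inner_diagonal (hF : ∀ x, F x = ∑ i, (μ i : ℂ) • ⟪e i, x⟫_ℂ • e i) (x : E) :
    (⟪F x, x⟫_ℂ).re = ∑ i, μ i * ‖⟪e i, x⟫_ℂ‖ ^ 2 := by
  rw [hF, sum_inner, Complex.re_sum]
  refine Finset.sum_congr rfl fun i _ => ?_
  rw [inner_smul_left, inner_smul_left, Complex.conj_ofReal, Complex.re_ofReal_mul,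
    mul_comm ((starRingEnd ℂ) _), Complex.mul_conj, Complex.normSq_eq_norm_sq, Complex.ofReal_re]

theorem eigPlus_diagonal_le (hE : ¬ FiniteDimensional ℂ E) (he : Orthonormal ℂ e)
    (hF : ∀ x, F x = ∑ i, (μ i : ℂ) • ⟪e i, x⟫_ℂ • e i) {c : ℝ} (hc : 0 ≤ c) {k : ℕ}
    (hk : (Finset.univ.filter fun i => c < μ i).card ≤ k) : eigPlus F k ≤ c := by
  refine eigPlus_le hE F ((rank_span_image_le e _).trans (by exact_mod_cast hk))
    fun u hu hu1 => ?_
  rw [re_inner_diagonal hF]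
  calc ∑ i, μ i * ‖⟪e i, u⟫_ℂ‖ ^ 2 ≤ ∑ i, c * ‖⟪e i, u⟫_ℂ‖ ^ 2 := by
        refine Finset.sum_le_sum fun i _ => ?_
        by_cases hi : c < μ i
        · have : ⟪e i, u⟫_ℂ = 0 := hu _ (Submodule.subset_span ⟨i, by simp [hi], rfl⟩)
          simp [this]
        · exact mul_le_mul_of_nonneg_right (not_lt.1 hi) (by positivity)
    _ = c * ∑ i, ‖⟪e i, u⟫_ℂ‖ ^ 2 := by rw [Finset.mul_sum]
    _ ≤ c * ‖u‖ ^ 2 := by gcongr; exact he.sum_inner_products_le u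
    _ = c := by simp [hu1]

theorem norm_sq_sum_smul (he : Orthonormal ℂ e) (a : ι → ℂ) :
    ‖∑ i, a i • e i‖ ^ 2 = ∑ i, ‖a i‖ ^ 2 := by
  have h := he.inner_sum a a Finset.univ
  have h1 : ((‖∑ i, a i • e i‖ ^ 2 : ℝ) : ℂ) = ((∑ i, ‖a i‖ ^ 2 : ℝ) : ℂ) := by
    push_cast
    have h0 := inner_self_eq_norm_sq_to_K (𝕜 := ℂ) (∑ i, a i • e i)
    rw [h] at h0
    refine h0.symm.trans ?_
    exact Finset.sum_congr rfl fun i _ => Complex.conj_mul' _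
  exact_mod_cast h1

theorem sVal_diagonal_le (he : Orthonormal ℂ e)
    (hF : ∀ x, F x = ∑ i, (μ i : ℂ) • ⟪e i, x⟫_ℂ • e i) {c : ℝ} (hc : 0 ≤ c) {k : ℕ}
    (hk : (Finset.univ.filter fun i => c < |μ i|).card ≤ k) : sVal F k ≤ c := by
  classical
  set S := Finset.univ.filter fun i => c < |μ i| with hS
  set G : E →L[ℂ] E := ∑ i ∈ S, (μ i : ℂ) • (innerSL ℂ (e i)).smulRight (e i) with hG
  have hG' : ∀ x, G x = ∑ i ∈ S, (μ i : ℂ) • ⟪e i, x⟫_ℂ • e i := by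
    intro x; simp [hG]
  have hrank : Module.rank ℂ (LinearMap.range (G : E →ₗ[ℂ] E)) ≤ (k : Cardinal) := by
    refine le_trans ?_ ((rank_span_image_le e S).trans (by exact_mod_cast hk))
    refine Submodule.rank_mono ?_
    rintro _ ⟨x, rfl⟩
    rw [ContinuousLinearMap.coe_coe, hG']
    exact Submodule.sum_mem _ fun i hi => Submodule.smul_mem _ _ (Submodule.smul_mem _ _
      (Submodule.subset_span ⟨i, hi, rfl⟩))
  refine (sVal_le F G hrank).trans (ContinuousLinearMap.opNorm_le_bound _ hc fun x => ?_)
  have h1 : (F - G) x = ∑ i, (if i ∈ S then 0 else (μ i : ℂ) * ⟪e i, x⟫_ℂ) • e i := by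
    rw [sub_apply, hF, hG', sub_eq_iff_eq_add,
      ← Finset.sum_filter_add_sum_filter_not Finset.univ (fun i => i ∈ S),
      ← Finset.sum_filter_add_sum_filter_not Finset.univ (fun i => i ∈ S)
        (fun i => (if i ∈ S then 0 else (μ i : ℂ) * ⟪e i, x⟫_ℂ) • e i)]
    have e1 : (Finset.univ.filter fun i => i ∈ S) = S := by ext; simp
    have e2 : ∑ i with i ∈ S, (if i ∈ S then 0 else (μ i : ℂ) * ⟪e i, x⟫_ℂ) • e i = 0 :=
      Finset.sum_eq_zero fun i hi => by simp [(Finset.mem_filter.1 hi).2]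
    have e3 : ∑ i with i ∉ S, (if i ∈ S then 0 else (μ i : ℂ) * ⟪e i, x⟫_ℂ) • e i =
        ∑ i with i ∉ S, (μ i : ℂ) • ⟪e i, x⟫_ℂ • e i :=
      Finset.sum_congr rfl fun i hi => by simp [(Finset.mem_filter.1 hi).2, mul_smul]
    rw [e2, e3, e1, zero_add, add_comm]
  have h2 : ‖(F - G) x‖ ^ 2 ≤ (c * ‖x‖) ^ 2 := by
    rw [h1, norm_sq_sum_smul he, mul_pow]
    calc _ ≤ ∑ i, c ^ 2 * ‖⟪e i, x⟫_ℂ‖ ^ 2 := by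
          refine Finset.sum_le_sum fun i _ => ?_
          split_ifs with hi
          · rw [norm_zero, zero_pow two_ne_zero]; positivity
          · rw [norm_mul, mul_pow]
            gcongr
            rw [Complex.norm_real]
            simpa [hS] using hi
      _ = c ^ 2 * ∑ i, ‖⟪e i, x⟫_ℂ‖ ^ 2 := by rw [Finset.mul_sum]
      _ ≤ _ := by gcongr; exact he.sum_inner_products_le x
  exact le_of_sq_le_sq h2 (by positivity)

theorem exists_combination_mem_ker (he : Orthonormal ℂ e) (S : Finset ι) {k : ℕ}
    (hS : k < S.card) (G : E →L[ℂ] E)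
    (hG : Module.rank ℂ (LinearMap.range (G : E →ₗ[ℂ] E)) ≤ (k : Cardinal)) :
    ∃ u : E, ‖u‖ = 1 ∧ G u = 0 ∧ (∀ i ∉ S, ⟪e i, u⟫_ℂ = 0) ∧ ∑ i, ‖⟪e i, u⟫_ℂ‖ ^ 2 = 1 ∧
      u = ∑ i, ⟪e i, u⟫_ℂ • e i := by
  classical
  have hdep : ¬ LinearIndependent ℂ (fun i : S => (G : E →ₗ[ℂ] E).rangeRestrict (e i)) := by
    intro hli
    have := finiteDimensional_of_rank_le hG
    have h1 := hli.fintype_card_le_finrank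
    have h2 : Module.finrank ℂ (LinearMap.range (G : E →ₗ[ℂ] E)) ≤ k :=
      Module.finrank_le_of_rank_le hG
    rw [Fintype.card_coe] at h1
    omega
  rw [Fintype.not_linearIndependent_iff] at hdep
  obtain ⟨g, hg, i₀, hi₀⟩ := hdep
  set a : ι → ℂ := fun i => if h : i ∈ S then g ⟨i, h⟩ else 0 with ha
  set v : E := ∑ i, a i • e i with hv
  have hvS : v = ∑ i : S, g i • e i := by
    rw [hv, ← Finset.sum_subset (Finset.subset_univ S), ← Finset.sum_coe_sort S]
    · exact Finset.sum_congr rfl fun i _ => by simp [ha]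
    · intro i _ hi; simp [ha, hi]
  have hGv : G v = 0 := by
    have := congrArg Subtype.val hg
    rw [hvS]
    simpa using this
  have hinner : ∀ i, ⟪e i, v⟫_ℂ = a i := fun i => by
    rw [hv]; exact he.inner_right_fintype a i
  have hv0 : v ≠ 0 := by
    intro h0
    have := hinner i₀
    rw [h0, inner_zero_right] at this
    exact hi₀ (by simpa [ha] using this.symm)
  have hn : (‖v‖ : ℂ) ≠ 0 := by exact_mod_cast norm_ne_zero_iff.2 hv0
  have hu : ‖((‖v‖ : ℂ)⁻¹) • v‖ = 1 := by
    rw [norm_smul, norm_inv, Complex.norm_real, norm_norm,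
      inv_mul_cancel₀ (norm_ne_zero_iff.2 hv0)]
  have hin : ∀ i, ⟪e i, ((‖v‖ : ℂ)⁻¹) • v⟫_ℂ = (‖v‖ : ℂ)⁻¹ * a i := fun i => by
    rw [inner_smul_right, hinner]
  have hexp : ((‖v‖ : ℂ)⁻¹) • v = ∑ i, ⟪e i, ((‖v‖ : ℂ)⁻¹) • v⟫_ℂ • e i := by
    simp only [hin, mul_smul]
    rw [← Finset.smul_sum]
  refine ⟨((‖v‖ : ℂ)⁻¹) • v, hu, by rw [map_smul, hGv, smul_zero], fun i hi => ?_, ?_, hexp⟩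
  · rw [hin]; simp [ha, hi]
  · rw [← norm_sq_sum_smul he, ← hexp, hu, one_pow]

theorem le_eigPlus_diagonal (he : Orthonormal ℂ e)
    (hF : ∀ x, F x = ∑ i, (μ i : ℂ) • ⟪e i, x⟫_ℂ • e i) {c : ℝ} {k : ℕ}
    (hk : k < (Finset.univ.filter fun i => c < μ i).card) : c ≤ eigPlus F k := by
  by_contra! hlt
  obtain ⟨c', hc', hc'c⟩ := exists_between hlt
  obtain ⟨V, hV, h⟩ := exists_of_eigPlus_lt F hc'
  have := finiteDimensional_of_rank_le hV
  have hr : Module.rank ℂ (LinearMap.range (V.starProjection : E →ₗ[ℂ] E)) ≤ (k : Cardinal) := by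
    have : LinearMap.range (V.starProjection : E →ₗ[ℂ] E) = V := V.range_starProjection
    rwa [this]
  obtain ⟨u, hu1, hu0, hS, hsum, -⟩ := exists_combination_mem_ker he _ hk _ hr
  have huV : u ∈ Vᗮ := V.starProjection_apply_eq_zero_iff.1 hu0
  have h1 := h u huV hu1
  rw [re_inner_diagonal hF] at h1
  have h2 : c ≤ ∑ i, μ i * ‖⟪e i, u⟫_ℂ‖ ^ 2 := by
    calc c = c * ∑ i, ‖⟪e i, u⟫_ℂ‖ ^ 2 := by rw [hsum, mul_one]
      _ = ∑ i, c * ‖⟪e i, u⟫_ℂ‖ ^ 2 := by rw [Finset.mul_sum]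
      _ ≤ _ := by
          refine Finset.sum_le_sum fun i _ => ?_
          by_cases hi : c < μ i
          · gcongr
          · rw [hS i (by simpa using hi)]; simp
  linarith

theorem le_sVal_diagonal (he : Orthonormal ℂ e)
    (hF : ∀ x, F x = ∑ i, (μ i : ℂ) • ⟪e i, x⟫_ℂ • e i) {c : ℝ} (hc : 0 ≤ c) {k : ℕ}
    (hk : k < (Finset.univ.filter fun i => c < |μ i|).card) : c ≤ sVal F k := by
  refine le_sVal F fun G hG => ?_
  obtain ⟨u, hu1, hu0, hS, hsum, -⟩ := exists_combination_mem_ker he _ hk G hG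
  have h1 : c ^ 2 ≤ ‖F u‖ ^ 2 := by
    have : F u = ∑ i, ((μ i : ℂ) * ⟪e i, u⟫_ℂ) • e i := by simp only [hF, mul_smul]
    rw [this, norm_sq_sum_smul he]
    calc c ^ 2 = ∑ i, c ^ 2 * ‖⟪e i, u⟫_ℂ‖ ^ 2 := by rw [← Finset.mul_sum, hsum, mul_one]
      _ ≤ _ := by
          refine Finset.sum_le_sum fun i _ => ?_
          by_cases hi : c < |μ i|
          · rw [norm_mul, mul_pow, Complex.norm_real, Real.norm_eq_abs]
            gcongr
          · rw [hS i (by simpa using hi)]; simp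
  have h2 : ‖(F - G) u‖ ≤ ‖F - G‖ := by simpa [hu1] using (F - G).le_opNorm u
  rw [sub_apply, hu0, sub_zero] at h2
  exact (le_of_sq_le_sq h1 (norm_nonneg _)).trans h2

theorem neg_diagonal (hF : ∀ x, F x = ∑ i, (μ i : ℂ) • ⟪e i, x⟫_ℂ • e i) (x : E) :
    (-F) x = ∑ i, (((fun i => -μ i) i : ℝ) : ℂ) • ⟪e i, x⟫_ℂ • e i := by
  simp [hF]

theorem card_filter_abs_eq {c : ℝ} (hc : 0 ≤ c) :
    (Finset.univ.filter fun i => c < |μ i|).card =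
      (Finset.univ.filter fun i => c < μ i).card +
      (Finset.univ.filter fun i => c < -μ i).card := by
  classical
  rw [← Finset.card_union_of_disjoint, ← Finset.filter_or]
  · simp only [lt_abs]
  · rw [Finset.disjoint_filter]
    intro i _ h1 h2
    linarith

theorem sVal_two_mul_le_of_diagonal (he : Orthonormal ℂ e)
    (hF : ∀ x, F x = ∑ i, (μ i : ℂ) • ⟪e i, x⟫_ℂ • e i) {k : ℕ} {c : ℝ} (hc : 0 ≤ c)
    (h1 : eigPlus F k < c) (h2 : eigPlus (-F) k < c) : sVal F (2 * k) ≤ c := by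
  refine sVal_diagonal_le he hF hc ?_
  rw [card_filter_abs_eq hc]
  have h3 : (Finset.univ.filter fun i => c < μ i).card ≤ k := by
    by_contra! h
    exact absurd (le_eigPlus_diagonal he hF h) (not_le.2 h1)
  have h4 : (Finset.univ.filter fun i => c < -μ i).card ≤ k := by
    by_contra! h
    exact absurd (le_eigPlus_diagonal he (neg_diagonal hF) h) (not_le.2 h2)
  omega

theorem le_sVal_two_mul_add_one_of_diagonal (hE : ¬ FiniteDimensional ℂ E)
    (he : Orthonormal ℂ e)
    (hF : ∀ x, F x = ∑ i, (μ i : ℂ) • ⟪e i, x⟫_ℂ • e i) {k : ℕ} {c : ℝ} (hc : 0 ≤ c)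
    (h1 : c < eigPlus F k) (h2 : c < eigPlus (-F) k) : c ≤ sVal F (2 * k + 1) := by
  refine le_sVal_diagonal he hF hc ?_
  rw [card_filter_abs_eq hc]
  have h3 : k < (Finset.univ.filter fun i => c < μ i).card := by
    by_contra! h
    exact absurd (eigPlus_diagonal_le hE he hF hc h) (not_le.2 h1)
  have h4 : k < (Finset.univ.filter fun i => c < -μ i).card := by
    by_contra! h
    exact absurd (eigPlus_diagonal_le hE he (neg_diagonal hF) hc h) (not_le.2 h2)
  omega

end Diagonal

theorem exists_diagonal_compression (A : E →L[ℂ] E) (hA : (A : E →ₗ[ℂ] E).IsSymmetric)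
    (W : Submodule ℂ E) [FiniteDimensional ℂ W] :
    ∃ (e : Fin (Module.finrank ℂ W) → E) (μ : Fin (Module.finrank ℂ W) → ℝ),
      Orthonormal ℂ e ∧ ∀ x, (W.starProjection ∘L A ∘L W.starProjection) x =
        ∑ i, (μ i : ℂ) • ⟪e i, x⟫_ℂ • e i := by
  set B : W →ₗ[ℂ] W := (W.orthogonalProjectionOnto : E →ₗ[ℂ] W) ∘ₗ (A : E →ₗ[ℂ] E) ∘ₗ W.subtype
  have hB : B.IsSymmetric := by
    intro x y
    have h1 : ⟪(B x : W), y⟫_ℂ = ⟪A x, (y : E)⟫_ℂ := by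
      simp [B]
    have h2 : ⟪x, (B y : W)⟫_ℂ = ⟪(x : E), A y⟫_ℂ := by
      simp [B]
    rw [h1, h2]
    exact hA x y
  set b := hB.eigenvectorBasis rfl
  refine ⟨fun i => (b i : E), hB.eigenvalues rfl, ?_, fun x => ?_⟩
  · exact b.orthonormal.comp_linearIsometry W.subtypeₗᵢ
  · have h1 : W.orthogonalProjectionOnto x = ∑ i, ⟪(b i : E), x⟫_ℂ • b i := by
      rw [← b.sum_repr' (W.orthogonalProjectionOnto x)]
      refine Finset.sum_congr rfl fun i _ => ?_
      congr 1
      simp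
    have h2 : (W.starProjection ∘L A ∘L W.starProjection) x =
        ((B (W.orthogonalProjectionOnto x) : W) : E) := by
      simp [B]
    rw [h2, h1, map_sum, Submodule.coe_sum]
    refine Finset.sum_congr rfl fun i _ => ?_
    rw [map_smul, hB.apply_eigenvectorBasis rfl i, Submodule.coe_smul, Submodule.coe_smul,
      smul_comm]
    rfl

theorem exists_diagonal_approx [CompleteSpace E] {A : E →L[ℂ] E}
    (hsym : (A : E →ₗ[ℂ] E).IsSymmetric) (hA : ∀ ε > 0, ∃ n, sVal A n < ε) {ε : ℝ} (hε : 0 < ε) :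
    ∃ (n : ℕ) (e : Fin n → E) (μ : Fin n → ℝ) (F : E →L[ℂ] E),
      Orthonormal ℂ e ∧ (∀ x, F x = ∑ i, (μ i : ℂ) • ⟪e i, x⟫_ℂ • e i) ∧ ‖A - F‖ < ε := by
  obtain ⟨n, hn⟩ := hA (ε / 2) (by positivity)
  obtain ⟨_, ⟨G, hG, rfl⟩, hGε⟩ := exists_lt_of_csInf_lt
    (s := (fun F : E →L[ℂ] E => ‖A - F‖) ''
      {F | Module.rank ℂ (LinearMap.range (F : E →ₗ[ℂ] E)) ≤ (n : Cardinal)})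
    ⟨_, 0, by simp, rfl⟩ hn
  set W := LinearMap.range (G : E →ₗ[ℂ] E) with hW
  have hfin : FiniteDimensional ℂ W := finiteDimensional_of_rank_le hG
  obtain ⟨e, μ, he, h⟩ := exists_diagonal_compression A hsym W
  refine ⟨_, e, μ, _, he, h, ?_⟩
  set P := W.starProjection with hP
  have hPn : ‖P‖ ≤ 1 := W.starProjection_norm_le
  have h1 : ‖A - P ∘L A‖ ≤ ‖A - G‖ := by
    refine ContinuousLinearMap.opNorm_le_bound _ (norm_nonneg _) fun x => ?_
    have hPG : P (G x) = G x := W.starProjection_eq_self_iff.2 ⟨x, rfl⟩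
    have : (A - P ∘L A) x = (A - G) x - P ((A - G) x) := by
      simp [hPG]
    rw [this]
    refine le_trans ?_ ((A - G).le_opNorm x)
    have h3 : (A - G) x - P ((A - G) x) = Wᗮ.starProjection ((A - G) x) := by
      rw [Submodule.starProjection_orthogonal_val]
    rw [h3]
    exact Submodule.norm_starProjection_apply_le _ _
  have hadj : A - A ∘L P = ContinuousLinearMap.adjoint (A - P ∘L A) := by
    have hAs : ContinuousLinearMap.adjoint A = A :=
      (ContinuousLinearMap.isSelfAdjoint_iff_isSymmetric.2 hsym)
    have hPs : ContinuousLinearMap.adjoint P = P := isSelfAdjoint_starProjection W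
    rw [map_sub, ContinuousLinearMap.adjoint_comp, hAs, hPs]
  have h2 : ‖A - A ∘L P‖ ≤ ‖A - G‖ := by
    rw [hadj, LinearIsometryEquiv.norm_map]; exact h1
  have h4 : A - P ∘L A ∘L P = (A - P ∘L A) + P ∘L (A - A ∘L P) := by
    ext x; simp
  have h5 : ‖P ∘L (A - A ∘L P)‖ ≤ ‖A - G‖ :=
    (ContinuousLinearMap.opNorm_comp_le _ _).trans
      ((mul_le_mul hPn h2 (norm_nonneg _) zero_le_one).trans_eq (one_mul _))
  rw [h4]
  have := norm_add_le (A - P ∘L A) (P ∘L (A - A ∘L P))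
  simp only at hGε
  linarith

theorem sVal_two_mul_le_max [CompleteSpace E] (hE : ¬ FiniteDimensional ℂ E) {A : E →L[ℂ] E}
    (hsym : (A : E →ₗ[ℂ] E).IsSymmetric) (hA : ∀ ε > 0, ∃ n, sVal A n < ε) (k : ℕ) :
    sVal A (2 * k) ≤ max (eigPlus A k) (eigPlus (-A) k) := by
  refine le_of_forall_pos_le_add fun ε hε => ?_
  obtain ⟨n, e, μ, F, he, hF, hAF⟩ := exists_diagonal_approx hsym hA (show 0 < ε / 3 by positivity)
  have hAF' : ‖F - A‖ < ε / 3 := by rwa [norm_sub_rev]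
  have hneg : ‖-F - -A‖ < ε / 3 := by
    rw [neg_sub_neg]; exact hAF
  have h1 := eigPlus_le_add_norm hE F A k
  have h2 := eigPlus_le_add_norm hE (-F) (-A) k
  have h3 := sVal_le_add_norm A F (2 * k)
  have h0 := le_max_of_le_left (c := eigPlus (-A) k) (eigPlus_nonneg hE hA k)
  have hl := le_max_left (eigPlus A k) (eigPlus (-A) k)
  have hr := le_max_right (eigPlus A k) (eigPlus (-A) k)
  have h4 := sVal_two_mul_le_of_diagonal he hF (k := k)
    (c := max (eigPlus A k) (eigPlus (-A) k) + 2 * (ε / 3)) (by linarith) (by linarith)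
    (by linarith)
  linarith

theorem min_le_sVal_two_mul_add_one [CompleteSpace E] (hE : ¬ FiniteDimensional ℂ E)
    {A : E →L[ℂ] E} (hsym : (A : E →ₗ[ℂ] E).IsSymmetric) (hA : ∀ ε > 0, ∃ n, sVal A n < ε)
    (k : ℕ) : min (eigPlus A k) (eigPlus (-A) k) ≤ sVal A (2 * k + 1) := by
  refine le_of_forall_pos_le_add fun ε hε => ?_
  obtain ⟨n, e, μ, F, he, hF, hAF⟩ := exists_diagonal_approx hsym hA (show 0 < ε / 3 by positivity)
  have hAF' : ‖F - A‖ < ε / 3 := by rwa [norm_sub_rev]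
  have hneg : ‖-A - -F‖ < ε / 3 := by
    rw [neg_sub_neg]; exact hAF'
  have h1 := eigPlus_le_add_norm hE A F k
  have h2 := eigPlus_le_add_norm hE (-A) (-F) k
  have h3 := sVal_le_add_norm F A (2 * k + 1)
  have hs := sVal_nonneg A (2 * k + 1)
  have hl := min_le_left (eigPlus A k) (eigPlus (-A) k)
  have hr := min_le_right (eigPlus A k) (eigPlus (-A) k)
  by_cases h0 : 0 ≤ min (eigPlus A k) (eigPlus (-A) k) - 2 * (ε / 3)
  · have h4 := le_sVal_two_mul_add_one_of_diagonal hE he hF (k := k) h0 (by linarith)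
      (by linarith)
    linarith
  · push Not at h0
    linarith

end Abstract

section Schur

theorem lintegral_mul_rpow_two_le {g U : ℝ → ℝ≥0∞} (hg : Measurable g) (hU : Measurable U)
    {a : ℝ≥0∞} (ha : ∫⁻ y, g y ≤ a) :
    (∫⁻ y, g y * U y) ^ (2 : ℝ) ≤ a * ∫⁻ y, g y * U y ^ (2 : ℝ) := by
  have h := ENNReal.lintegral_mul_le_Lp_mul_Lq volume Real.HolderConjugate.two_two
    (f := fun y => g y ^ (1 / 2 : ℝ)) (g := fun y => g y ^ (1 / 2 : ℝ) * U y)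
    (hg.pow_const _).aemeasurable ((hg.pow_const _).mul hU).aemeasurable
  have e1 : ∀ y, ((fun y => g y ^ (1 / 2 : ℝ)) * fun y => g y ^ (1 / 2 : ℝ) * U y) y
      = g y * U y := fun y => by
    simp only [Pi.mul_apply]
    rw [← mul_assoc, ← ENNReal.rpow_add_of_nonneg _ _ (by norm_num) (by norm_num)]
    norm_num
  have e2 : ∀ y, (g y ^ (1 / 2 : ℝ)) ^ (2 : ℝ) = g y := fun y => by
    rw [← ENNReal.rpow_mul]; norm_num
  have e3 : ∀ y, (g y ^ (1 / 2 : ℝ) * U y) ^ (2 : ℝ) = g y * U y ^ (2 : ℝ) := fun y => by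
    rw [ENNReal.mul_rpow_of_nonneg _ _ (by norm_num), e2]
  simp only [e1, e2, e3] at h
  calc (∫⁻ y, g y * U y) ^ (2 : ℝ)
      ≤ ((∫⁻ y, g y) ^ (1 / 2 : ℝ) * (∫⁻ y, g y * U y ^ (2 : ℝ)) ^ (1 / 2 : ℝ)) ^ (2 : ℝ) := by
        gcongr
    _ = (∫⁻ y, g y) * ∫⁻ y, g y * U y ^ (2 : ℝ) := by
        rw [ENNReal.mul_rpow_of_nonneg _ _ (by norm_num), ← ENNReal.rpow_mul, ← ENNReal.rpow_mul]
        norm_num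
    _ ≤ a * ∫⁻ y, g y * U y ^ (2 : ℝ) := by gcongr

/-- Schur's test. -/
theorem eLpNorm_le_of_schur {G : ℝ → ℝ → ℝ≥0∞} (hG : Measurable (Function.uncurry G))
    {F U : ℝ → ℂ} (hU : Measurable U) {c : ℝ≥0∞} (h1 : ∀ x, ∫⁻ y, G x y ≤ c)
    (h2 : ∀ y, ∫⁻ x, G x y ≤ c) (hF : ∀ᵐ x, ‖F x‖ₑ ≤ ∫⁻ y, G x y * ‖U y‖ₑ) :
    eLpNorm F 2 volume ≤ c * eLpNorm U 2 volume := by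
  have key : ∫⁻ x, ‖F x‖ₑ ^ (2 : ℝ) ≤ c ^ (2 : ℝ) * ∫⁻ y, ‖U y‖ₑ ^ (2 : ℝ) := by
    have hGm : ∀ x, Measurable (G x) := fun x => hG.comp measurable_prodMk_left
    calc ∫⁻ x, ‖F x‖ₑ ^ (2 : ℝ) ≤ ∫⁻ x, (c * ∫⁻ y, G x y * ‖U y‖ₑ ^ (2 : ℝ)) := by
          refine lintegral_mono_ae (hF.mono fun x hx => ?_)
          exact (ENNReal.rpow_le_rpow hx (by norm_num)).trans
            (lintegral_mul_rpow_two_le (hGm x) hU.enorm (h1 x))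
      _ = c * ∫⁻ x, ∫⁻ y, G x y * ‖U y‖ₑ ^ (2 : ℝ) := by
          rw [lintegral_const_mul]
          exact (hG.mul ((hU.enorm.pow_const _).comp measurable_snd)).lintegral_prod_right'
      _ = c * ∫⁻ y, ∫⁻ x, G x y * ‖U y‖ₑ ^ (2 : ℝ) := by
          rw [lintegral_lintegral_swap]
          exact (hG.mul ((hU.enorm.pow_const _).comp measurable_snd)).aemeasurable
      _ ≤ c * ∫⁻ y, c * ‖U y‖ₑ ^ (2 : ℝ) := by
          gcongr with y
          rw [lintegral_mul_const (f := fun x => G x y) _ (hG.comp measurable_prodMk_right)]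
          gcongr
          exact h2 y
      _ = c ^ (2 : ℝ) * ∫⁻ y, ‖U y‖ₑ ^ (2 : ℝ) := by
          rw [lintegral_const_mul _ (hU.enorm.pow_const _), ← mul_assoc, ENNReal.rpow_two, sq]
  rw [eLpNorm_eq_lintegral_rpow_enorm_toReal (by norm_num) (by norm_num),
    eLpNorm_eq_lintegral_rpow_enorm_toReal (by norm_num) (by norm_num)]
  simp only [ENNReal.toReal_ofNat]
  calc (∫⁻ x, ‖F x‖ₑ ^ (2 : ℝ)) ^ (1 / 2 : ℝ)
      ≤ (c ^ (2 : ℝ) * ∫⁻ y, ‖U y‖ₑ ^ (2 : ℝ)) ^ (1 / 2 : ℝ) := by gcongr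
    _ = c * (∫⁻ y, ‖U y‖ₑ ^ (2 : ℝ)) ^ (1 / 2 : ℝ) := by
        rw [ENNReal.mul_rpow_of_nonneg _ _ (by norm_num), ← ENNReal.rpow_mul]
        norm_num

end Schur

section StepApprox

theorem dense_schwartz : DenseRange fun u : SchwartzMap ℝ ℂ => (u.toLp 2 volume : L2R) := by
  exact SchwartzMap.denseRange_toLpCLM (E := ℝ) (F := ℂ) (p := 2) (μ := volume) (by norm_num)

/-- Approximation by step functions: the singular values of an operator are controlled once its
values on Schwartz functions are close to step functions subordinate to finitely many cells. -/
theorem sVal_le_of_step {ι : Type*} [MeasurableSpace ι] [MeasurableSingletonClass ι]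
    [DecidableEq ι] (A : L2R →L[ℂ] L2R) {q : ℝ → ι} (hq : Measurable q) (S : Finset ι)
    (hS : ∀ i ∈ S, volume (q ⁻¹' {i}) ≠ ∞) {G : ℝ → ℝ → ℝ≥0∞}
    (hG : Measurable (Function.uncurry G)) {c : ℝ} (hc : 0 ≤ c)
    (h1 : ∀ x, ∫⁻ y, G x y ≤ ENNReal.ofReal c) (h2 : ∀ y, ∫⁻ x, G x y ≤ ENNReal.ofReal c)
    (hA : ∀ u : SchwartzMap ℝ ℂ, ∃ b : ι → ℂ, ∀ᵐ x,
      ‖A (u.toLp 2 volume) x - (if q x ∈ S then b (q x) else 0)‖ₑ ≤ ∫⁻ y, G x y * ‖u y‖ₑ)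
    {k : ℕ} (hk : S.card ≤ k) : sVal A k ≤ c := by
  let e : ι → L2R := fun i => if h : volume (q ⁻¹' {i}) ≠ ∞ then
    indicatorConstLp 2 (hq (measurableSet_singleton i)) h 1 else 0
  let V : Submodule ℂ L2R := Submodule.span ℂ (e '' S)
  have hVr : Module.rank ℂ V ≤ (S.card : Cardinal) := rank_span_image_le e S
  have := finiteDimensional_of_rank_le hVr
  let F : L2R →L[ℂ] L2R := V.starProjection.comp A
  have hF : Module.rank ℂ (LinearMap.range (F : L2R →ₗ[ℂ] L2R)) ≤ (k : Cardinal) := by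
    refine le_trans (Submodule.rank_mono ?_) (hVr.trans (by exact_mod_cast hk))
    rintro _ ⟨x, rfl⟩
    exact Submodule.starProjection_apply_mem V (A x)
  refine (sVal_le A F hF).trans (ContinuousLinearMap.opNorm_le_bound _ hc fun f => ?_)
  refine dense_schwartz.induction_on (p := fun f => ‖(A - F) f‖ ≤ c * ‖f‖) f
    (isClosed_le (by fun_prop) (by fun_prop)) fun u => ?_
  obtain ⟨b, hb⟩ := hA u
  set f : L2R := u.toLp 2 volume
  set v : L2R := ∑ i ∈ S, b i • e i with hv
  have hvV : v ∈ V := Submodule.sum_mem _ fun i hi => Submodule.smul_mem _ _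
    (Submodule.subset_span ⟨i, hi, rfl⟩)
  have hmin : ‖(A - F) f‖ ≤ ‖A f - v‖ := by
    have hz := Submodule.starProjection_minimal (U := V) (A f)
    have : ‖A f - V.starProjection (A f)‖ ≤ ‖A f - v‖ := by
      rw [hz]
      exact ciInf_le ⟨0, by rintro _ ⟨w, rfl⟩; exact norm_nonneg _⟩ (⟨v, hvV⟩ : V)
    simpa [F] using this
  have hvae : ∀ᵐ x, v x = if q x ∈ S then b (q x) else 0 := by
    have he : ∀ i ∈ S, ∀ᵐ x, (b i • e i : L2R) x = if q x = i then b i else 0 := fun i hi => by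
      have h3 : e i = indicatorConstLp 2 (hq (measurableSet_singleton i)) (hS i hi) 1 := by
        simp only [e]; rw [dif_pos (hS i hi)]
      rw [h3]
      filter_upwards [Lp.coeFn_smul (b i)
        (indicatorConstLp 2 (hq (measurableSet_singleton i)) (hS i hi) (1 : ℂ)),
        indicatorConstLp_coeFn (p := 2) (hs := hq (measurableSet_singleton i)) (hμs := hS i hi)
          (c := (1 : ℂ))] with x hx hx'
      rw [hx, Pi.smul_apply, hx']
      by_cases hqx : q x = i <;> simp [Set.indicator, hqx]
    have hall : ∀ᵐ x, ∀ i ∈ S, (b i • e i : L2R) x = if q x = i then b i else 0 :=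
      (ae_ball_iff S.countable_toSet).2 he
    have hsum : ∀ᵐ x, v x = ∑ i ∈ S, (b i • e i : L2R) x := by
      have := Lp.coeFn_finsetSum S (fun i => (b i • e i : L2R))
      filter_upwards [this] with x hx
      rw [hv, hx, Finset.sum_apply]
    filter_upwards [hall, hsum] with x h3 h4
    rw [h4, Finset.sum_congr rfl h3, Finset.sum_ite_eq]
  refine hmin.trans ?_
  rw [Lp.norm_def, Lp.norm_def, ← ENNReal.toReal_ofReal hc, ← ENNReal.toReal_mul]
  refine ENNReal.toReal_mono (ENNReal.mul_ne_top ENNReal.ofReal_ne_top (Lp.eLpNorm_ne_top f)) ?_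
  rw [eLpNorm_congr_ae (SchwartzMap.coeFn_toLp u 2 volume)]
  refine eLpNorm_le_of_schur hG u.continuous.measurable h1 h2 ?_
  filter_upwards [hb, hvae, Lp.coeFn_sub (A f) v] with x h3 h4 h5
  rw [h5, Pi.sub_apply, h4]
  exact h3

end StepApprox

section Kernel

/-- `A` acts on Schwartz functions as the integral operator with kernel `K`. -/
def HasKernel (A : L2R →L[ℂ] L2R) (K : ℝ → ℝ → ℂ) : Prop :=
  ∀ u : SchwartzMap ℝ ℂ, ∀ᵐ x, A (u.toLp 2 volume) x = ∫ y, K x y * u y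

/-- A kernel supported in the strip `0 < x + y < R` which is bounded by `w n` and Lipschitz in the
first variable with constant `w n` inside the half-plane `0 < x + y`, for `n = ⌊x⌋`. -/
structure IsStripKernel (K : ℝ → ℝ → ℂ) (w : ℤ → ℝ) (R : ℝ) : Prop where
  measurable : ∀ x, Measurable (K x)
  supp : ∀ x y, ¬ (0 < x + y ∧ x + y < R) → K x y = 0
  bound : ∀ x y, ‖K x y‖ ≤ w ⌊x⌋
  lipschitz : ∀ x x' y, ⌊x'⌋ = ⌊x⌋ → 0 < x + y → 0 < x' + y → x' ≤ x →
    ‖K x y - K x' y‖ ≤ w ⌊x⌋ * (x - x')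

theorem integrable_kernel_mul {K : ℝ → ℝ → ℂ} {w : ℤ → ℝ} {R : ℝ} (hK : IsStripKernel K w R)
    (x : ℝ) (u : SchwartzMap ℝ ℂ) : Integrable fun y => K x y * u y :=
  u.integrable.bdd_mul (hK.measurable x).aestronglyMeasurable
    (Eventually.of_forall fun y => hK.bound x y)

/-- The dominating kernel in Schur's test. -/
def schurKernel (R δ : ℝ) (w : ℤ → ℝ) (h : ℤ → ℝ) (x y : ℝ) : ℝ≥0∞ :=
  (Set.Ioo 0 (R + 1)).indicator (fun _ => ENNReal.ofReal δ) (x + y) +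
    (if 0 < x + y ∧ x + y < h ⌊x⌋ then ENNReal.ofReal (w ⌊x⌋) else 0)

theorem measurable_schurKernel (R δ : ℝ) (w h : ℤ → ℝ) :
    Measurable (Function.uncurry (schurKernel R δ w h)) := by
  have hf : Measurable fun p : ℝ × ℝ => ⌊p.1⌋ := Int.measurable_floor.comp measurable_fst
  have hw : Measurable fun p : ℝ × ℝ => w ⌊p.1⌋ := (measurable_from_top (f := w)).comp hf
  have hh : Measurable fun p : ℝ × ℝ => h ⌊p.1⌋ := (measurable_from_top (f := h)).comp hf
  have ha : Measurable fun p : ℝ × ℝ => p.1 + p.2 := measurable_fst.add measurable_snd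
  refine Measurable.add ?_ ?_
  · exact (measurable_const.indicator measurableSet_Ioo).comp ha
  · exact Measurable.ite ((measurableSet_lt measurable_const ha).inter (measurableSet_lt ha hh))
      hw.ennreal_ofReal measurable_const

theorem lintegral_indicator_add_right (a b : ℝ) (c : ℝ≥0∞) (x : ℝ) :
    ∫⁻ y, (Set.Ioo a b).indicator (fun _ => c) (x + y) = c * ENNReal.ofReal (b - a) := by
  rw [lintegral_add_left_eq_self (fun z => (Set.Ioo a b).indicator (fun _ => c) z) x,
    lintegral_indicator measurableSet_Ioo, lintegral_const, Measure.restrict_apply_univ,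
    Real.volume_Ioo]

theorem lintegral_schurKernel_right_le {R δ : ℝ} {w h : ℤ → ℝ} (hR : 0 ≤ R) (hδ : 0 ≤ δ)
    (hw : ∀ n, 0 ≤ w n) (hwh : ∀ n, w n * h n ≤ δ) (x : ℝ) :
    ∫⁻ y, schurKernel R δ w h x y ≤ ENNReal.ofReal ((R + 3) * δ) := by
  have e : ∀ y, schurKernel R δ w h x y = (Set.Ioo 0 (R + 1)).indicator
      (fun _ => ENNReal.ofReal δ) (x + y) + (Set.Ioo 0 (h ⌊x⌋)).indicator
      (fun _ => ENNReal.ofReal (w ⌊x⌋)) (x + y) := fun y => by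
    simp only [schurKernel, Set.indicator_apply, Set.mem_Ioo]
  simp only [e]
  have hm : Measurable fun y => (Set.Ioo 0 (R + 1)).indicator (fun _ => ENNReal.ofReal δ) (x + y) :=
    (measurable_const.indicator measurableSet_Ioo).comp (measurable_const_add x)
  rw [lintegral_add_left hm,
    lintegral_indicator_add_right, lintegral_indicator_add_right, sub_zero, sub_zero,
    ← ENNReal.ofReal_mul hδ, ← ENNReal.ofReal_mul (hw _)]
  have h1 : (R + 3) * δ = δ * (R + 1) + 2 * δ := by ring
  rw [h1, ENNReal.ofReal_add (by positivity) (by positivity)]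
  exact add_le_add le_rfl (ENNReal.ofReal_le_ofReal (by linarith [hwh ⌊x⌋]))

theorem lintegral_schurKernel_left_le {R δ : ℝ} {w h : ℤ → ℝ} (hR : 0 ≤ R) (hδ : 0 ≤ δ)
    (hw : ∀ n, 0 ≤ w n) (h1 : ∀ n, h n ≤ 1) (hwh : ∀ n, w n * h n ≤ δ) (y : ℝ) :
    ∫⁻ x, schurKernel R δ w h x y ≤ ENNReal.ofReal ((R + 3) * δ) := by
  set n₀ := ⌊-y⌋
  have e : ∀ x, schurKernel R δ w h x y ≤ (Set.Ioo 0 (R + 1)).indicator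
      (fun _ => ENNReal.ofReal δ) (y + x) + ((Set.Ioo 0 (h n₀)).indicator
      (fun _ => ENNReal.ofReal (w n₀)) (y + x) + (Set.Ioo 0 (h (n₀ + 1))).indicator
      (fun _ => ENNReal.ofReal (w (n₀ + 1))) (y + x)) := fun x => by
    simp only [schurKernel, Set.indicator_apply, Set.mem_Ioo, add_comm x y]
    gcongr
    by_cases hx : 0 < y + x ∧ y + x < h ⌊x⌋
    · rw [if_pos hx]
      have hx1 : ⌊x⌋ = n₀ ∨ ⌊x⌋ = n₀ + 1 := by
        have h3 : n₀ ≤ ⌊x⌋ := Int.floor_le_floor (by linarith)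
        have h4 : ⌊x⌋ < n₀ + 2 := by
          rw [Int.floor_lt]
          push_cast
          have := Int.lt_floor_add_one (-y)
          have := h1 ⌊x⌋
          linarith [hx.2]
        omega
      rcases hx1 with h3 | h3 <;> rw [h3] at hx ⊢ <;> simp [hx]
    · simp [if_neg hx]
  refine (lintegral_mono e).trans ?_
  have hm : ∀ (a : ℝ) (c : ℝ≥0∞), Measurable fun x =>
      (Set.Ioo 0 a).indicator (fun _ => c) (y + x) := fun a c =>
    (measurable_const.indicator measurableSet_Ioo).comp (measurable_const_add y)
  rw [lintegral_add_left (hm _ _), lintegral_add_left (hm _ _),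
    lintegral_indicator_add_right, lintegral_indicator_add_right, lintegral_indicator_add_right,
    sub_zero, sub_zero, sub_zero, ← ENNReal.ofReal_mul hδ, ← ENNReal.ofReal_mul (hw _),
    ← ENNReal.ofReal_mul (hw _)]
  have h2 : (R + 3) * δ = δ * (R + 1) + (δ + δ) := by ring
  rw [h2, ENNReal.ofReal_add (by positivity) (by positivity), ENNReal.ofReal_add hδ hδ]
  gcongr <;> apply hwh

theorem norm_kernel_sub_le {K : ℝ → ℝ → ℂ} {w : ℤ → ℝ} {R δ : ℝ} (hK : IsStripKernel K w R)
    {x a y h : ℝ} (ha : a ≤ x) (hfl : ⌊a⌋ = ⌊x⌋) (hxa : x < a + h) (h1 : h ≤ 1)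
    (hw : 0 ≤ w ⌊x⌋) (hwh : w ⌊x⌋ * h ≤ δ) :
    ‖K x y - K a y‖ₑ ≤ (Set.Ioo 0 (R + 1)).indicator (fun _ => ENNReal.ofReal δ) (x + y) +
      (if 0 < x + y ∧ x + y < h then ENNReal.ofReal (w ⌊x⌋) else 0) := by
  rw [← ofReal_norm]
  by_cases hay : 0 < a + y
  · have hxy : 0 < x + y := by linarith
    by_cases hxR : x + y < R + 1
    · rw [Set.indicator_of_mem (show x + y ∈ Set.Ioo 0 (R + 1) from ⟨hxy, hxR⟩)]
      refine le_trans (ENNReal.ofReal_le_ofReal ?_) le_self_add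
      refine (hK.lipschitz x a y hfl hxy hay ha).trans (le_trans ?_ hwh)
      gcongr
      linarith
    · rw [hK.supp x y (fun h' => hxR (by linarith [h'.2])),
        hK.supp a y (fun h' => hxR (by linarith [h'.2]))]
      simp
  · rw [hK.supp a y (fun h' => hay h'.1), sub_zero]
    by_cases hxy : 0 < x + y
    · rw [if_pos ⟨hxy, by linarith⟩]
      exact le_trans (ENNReal.ofReal_le_ofReal (hK.bound x y)) le_add_self
    · rw [hK.supp x y (fun h' => hxy h'.1)]
      simp

theorem norm_kernel_le {K : ℝ → ℝ → ℂ} {w : ℤ → ℝ} {R δ : ℝ} (hK : IsStripKernel K w R)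
    {x y : ℝ} (hw : w ⌊x⌋ ≤ δ) :
    ‖K x y‖ₑ ≤ (Set.Ioo 0 (R + 1)).indicator (fun _ => ENNReal.ofReal δ) (x + y) := by
  by_cases hxy : 0 < x + y ∧ x + y < R
  · rw [Set.indicator_of_mem (show x + y ∈ Set.Ioo 0 (R + 1) from ⟨hxy.1, by linarith [hxy.2]⟩),
      ← ofReal_norm]
    exact ENNReal.ofReal_le_ofReal ((hK.bound x y).trans hw)
  · rw [hK.supp x y hxy]
    simp

theorem sVal_le_of_stripKernel {A : L2R →L[ℂ] L2R} {K : ℝ → ℝ → ℂ} {w : ℤ → ℝ} {R : ℝ}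
    (hA : HasKernel A K) (hK : IsStripKernel K w R) (hR : 0 ≤ R) (hw : ∀ n, 0 ≤ w n)
    {δ : ℝ} (hδ : 0 < δ) (s : Finset ℤ) (hs : ∀ n, n ∉ s → w n ≤ δ) {k : ℕ}
    (hk : ∑ n ∈ s, (⌈w n / δ⌉₊ + 1) ≤ k) : sVal A k ≤ (R + 3) * δ := by
  let m : ℤ → ℕ := fun n => ⌈w n / δ⌉₊ + 1
  have hm0 : ∀ n, (0 : ℝ) < m n := fun n => by simp only [m]; positivity
  let h : ℤ → ℝ := fun n => (m n : ℝ)⁻¹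
  have h1 : ∀ n, h n ≤ 1 := fun n => inv_le_one_of_one_le₀ (by simp [m])
  have hwh : ∀ n, w n * h n ≤ δ := fun n => by
    simp only [h]
    rw [← div_eq_mul_inv, div_le_iff₀ (hm0 n), ← div_le_iff₀' hδ]
    refine (Nat.le_ceil _).trans ?_
    simp [m]
  let q : ℝ → ℤ × ℤ := fun x => (⌊x⌋, ⌊(m ⌊x⌋ : ℝ) * x⌋)
  have hq : Measurable q := by
    refine Int.measurable_floor.prodMk (Int.measurable_floor.comp (Measurable.mul ?_ measurable_id))
    exact (measurable_from_top (f := fun n : ℤ => (m n : ℝ))).comp Int.measurable_floor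
  let S : Finset (ℤ × ℤ) := s.biUnion fun n =>
    (Finset.Ico ((m n : ℤ) * n) (m n * n + m n)).image (Prod.mk n)
  have hS : ∀ x, q x ∈ S ↔ ⌊x⌋ ∈ s := fun x => by
    simp only [S, q, Finset.mem_biUnion, Finset.mem_image, Finset.mem_Ico, Prod.mk.injEq]
    refine ⟨?_, fun hx => ⟨⌊x⌋, hx, _, ⟨?_, ?_⟩, rfl, rfl⟩⟩
    · rintro ⟨n, hn, l, -, rfl, -⟩
      exact hn
    · rw [Int.le_floor]
      push_cast
      exact mul_le_mul_of_nonneg_left (Int.floor_le x) (hm0 _).le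
    · rw [Int.floor_lt]
      push_cast
      rw [← mul_add_one]
      exact mul_lt_mul_of_pos_left (Int.lt_floor_add_one x) (hm0 _)
  have hcard : S.card ≤ k := by
    refine Finset.card_biUnion_le.trans (le_trans (Finset.sum_le_sum fun n _ => ?_) hk)
    refine Finset.card_image_le.trans ?_
    simp [m]
  refine sVal_le_of_step A hq S (fun i _ => ?_) (measurable_schurKernel R δ w h) (by positivity)
    (lintegral_schurKernel_right_le hR hδ.le hw hwh)
    (lintegral_schurKernel_left_le hR hδ.le hw h1 hwh) (fun u => ?_) hcard
  · refine ne_top_of_le_ne_top (measure_Ico_lt_top (a := (i.1 : ℝ)) (b := i.1 + 1)).ne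
      (measure_mono ?_)
    rintro x hx
    have hx1 : ⌊x⌋ = i.1 := congrArg Prod.fst hx
    rw [Int.floor_eq_iff] at hx1
    exact hx1
  · refine ⟨fun i => ∫ y, K (i.2 / m i.1) y * u y, ?_⟩
    filter_upwards [hA u] with x hx
    rw [hx]
    by_cases hxs : ⌊x⌋ ∈ s
    · rw [if_pos ((hS x).2 hxs)]
      set a : ℝ := (⌊(m ⌊x⌋ : ℝ) * x⌋ : ℝ) / m ⌊x⌋ with ha
      have hax : a ≤ x := by
        rw [ha, div_le_iff₀ (hm0 _), mul_comm x]
        exact Int.floor_le _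
      have hxa : x < a + h ⌊x⌋ := by
        simp only [h]
        rw [ha, ← one_div, ← add_div, lt_div_iff₀ (hm0 _), mul_comm x]
        exact Int.lt_floor_add_one _
      have hfl : ⌊a⌋ = ⌊x⌋ := by
        rw [Int.floor_eq_iff]
        refine ⟨?_, hax.trans_lt (Int.lt_floor_add_one x)⟩
        rw [ha, le_div_iff₀ (hm0 _), mul_comm]
        have : ((m ⌊x⌋ : ℤ) * ⌊x⌋ : ℤ) ≤ ⌊(m ⌊x⌋ : ℝ) * x⌋ := by
          rw [Int.le_floor]
          push_cast
          exact mul_le_mul_of_nonneg_left (Int.floor_le x) (hm0 _).le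
        exact_mod_cast this
      change ‖(∫ y, K x y * u y) - ∫ y, K a y * u y‖ₑ ≤ _
      rw [← integral_sub (integrable_kernel_mul hK x u) (integrable_kernel_mul hK a u)]
      refine (enorm_integral_le_lintegral_enorm _).trans (lintegral_mono fun y => ?_)
      rw [← sub_mul, enorm_mul]
      gcongr
      exact norm_kernel_sub_le hK hax hfl hxa (h1 _) (hw _) (hwh _)
    · rw [if_neg (fun h' => hxs ((hS x).1 h')), sub_zero]
      refine (enorm_integral_le_lintegral_enorm _).trans (lintegral_mono fun y => ?_)
      rw [enorm_mul]
      gcongr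
      exact (norm_kernel_le hK (hs _ hxs)).trans le_self_add

end Kernel

section KernelDecay

theorem exists_sVal_lt_of_stripKernel {A : L2R →L[ℂ] L2R} {K : ℝ → ℝ → ℂ} {w : ℤ → ℝ} {R : ℝ}
    (hA : HasKernel A K) (hK : IsStripKernel K w R) (hR : 0 ≤ R) (hw : ∀ n, 0 ≤ w n)
    (hw0 : Tendsto w cofinite (nhds 0)) {ε : ℝ} (hε : 0 < ε) : ∃ n, sVal A n < ε := by
  have hδ : 0 < ε / (2 * (R + 3)) := by positivity
  have hfin : {n | ¬ w n < ε / (2 * (R + 3))}.Finite := hw0.eventually (gt_mem_nhds hδ)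
  refine ⟨_, (sVal_le_of_stripKernel hA hK hR hw hδ hfin.toFinset (fun n hn => ?_)
    le_rfl).trans_lt ?_⟩
  · simp only [Set.Finite.mem_toFinset, Set.mem_ofPred_eq, not_not] at hn
    exact hn.le
  · rw [← mul_div_assoc, div_lt_iff₀ (by positivity)]
    nlinarith

theorem summable_inv_one_add_sq : Summable fun n : ℤ => 1 / (1 + (n : ℝ) ^ 2) := by
  refine Summable.of_nonneg_of_le (fun n => by positivity) (fun n => ?_)
    (((Real.summable_one_div_int_add_rpow (1 / 2) 2).2 (by norm_num)).mul_left 2)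
  have h0 : ((n : ℝ) + 1 / 2) ≠ 0 := fun h => by
    have h1 : (2 * n + 1 : ℤ) = 0 := by
      have : (2 * (n : ℝ) + 1) = 0 := by linarith
      exact_mod_cast this
    omega
  have h1 : 0 < |(n : ℝ) + 1 / 2| ^ (2 : ℝ) := Real.rpow_pos_of_pos (abs_pos.2 h0) _
  rw [mul_one_div, div_le_div_iff₀ (by positivity) h1, Real.rpow_two, sq_abs]
  nlinarith [sq_nonneg ((n : ℝ) - 1 / 2)]

theorem exists_sVal_le_of_stripKernel {A : L2R →L[ℂ] L2R} {K : ℝ → ℝ → ℂ} {C R : ℝ}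
    (hA : HasKernel A K) (hC : 0 < C) (hK : IsStripKernel K (fun n => C / (1 + (n : ℝ) ^ 2)) R)
    (hR : 0 ≤ R) : ∃ C', 0 ≤ C' ∧ ∀ k : ℕ, sVal A k ≤ C' / (k + 1) := by
  set S : ℝ := ∑' n : ℤ, 1 / (1 + (n : ℝ) ^ 2) with hS
  have hS0 : 0 ≤ S := tsum_nonneg fun n => by positivity
  set D : ℕ := ⌈S⌉₊ + 6 with hD
  have hSD : S + 6 ≤ D := by
    rw [hD]
    push_cast
    linarith [Nat.le_ceil S]
  have key : ∀ N : ℕ, 1 ≤ N → sVal A (N * D) ≤ (R + 3) * (C / N) := fun N hN => by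
    have hN0 : (1 : ℝ) ≤ N := by exact_mod_cast hN
    refine sVal_le_of_stripKernel hA hK hR (fun n => by positivity) (by positivity)
      (Finset.Icc (-(N : ℤ)) N) (fun n hn => ?_) ?_
    · have h1 : (N : ℝ) ≤ (n : ℝ) ^ 2 := by
        have h2 : (N : ℤ) ≤ n ^ 2 := by
          by_contra hlt
          refine hn (Finset.mem_Icc.2 ⟨?_, ?_⟩) <;> nlinarith
        exact_mod_cast h2
      gcongr
      linarith
    · have h3 : ∀ n : ℤ, ((⌈C / (1 + (n : ℝ) ^ 2) / (C / N)⌉₊ + 1 : ℕ) : ℝ) ≤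
          N * (1 / (1 + (n : ℝ) ^ 2)) + 2 := fun n => by
        have h4 : C / (1 + (n : ℝ) ^ 2) / (C / N) = N * (1 / (1 + (n : ℝ) ^ 2)) := by
          field_simp
        rw [h4]
        push_cast
        have := Nat.ceil_lt_add_one (a := N * (1 / (1 + (n : ℝ) ^ 2))) (by positivity)
        linarith
      have h5 : ((∑ n ∈ Finset.Icc (-(N : ℤ)) N,
          (⌈C / (1 + (n : ℝ) ^ 2) / (C / N)⌉₊ + 1) : ℕ) : ℝ) ≤ N * D := by
        rw [Nat.cast_sum]
        refine (Finset.sum_le_sum fun n _ => h3 n).trans ?_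
        rw [Finset.sum_add_distrib, ← Finset.mul_sum, Finset.sum_const, Int.card_Icc]
        have h6 : (((N : ℤ) + 1 - -(N : ℤ)).toNat : ℝ) = 2 * N + 1 := by
          have : ((N : ℤ) + 1 - -(N : ℤ)).toNat = 2 * N + 1 := by omega
          rw [this]
          push_cast
          ring
        have h7 : ∑ n ∈ Finset.Icc (-(N : ℤ)) N, 1 / (1 + (n : ℝ) ^ 2) ≤ S :=
          summable_inv_one_add_sq.sum_le_tsum _ fun n _ => by positivity
        rw [nsmul_eq_mul, h6]
        nlinarith
      exact_mod_cast h5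
  have hD0 : (0 : ℝ) < D := by linarith
  refine ⟨‖A‖ * D + (R + 3) * C * (2 * D), by positivity, fun k => ?_⟩
  rw [le_div_iff₀ (by positivity)]
  rcases lt_or_ge k D with hkD | hkD
  · have h1 : ((k : ℝ) + 1) ≤ D := by exact_mod_cast hkD
    have h2 : sVal A k * (k + 1) ≤ ‖A‖ * D :=
      mul_le_mul (sVal_le_norm A k) h1 (by positivity) (norm_nonneg _)
    have : 0 ≤ (R + 3) * C * (2 * D) := by positivity
    linarith
  · have hN : 1 ≤ k / D := (Nat.one_le_div_iff (by omega)).2 hkD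
    have h1 := (sVal_antitone A (Nat.div_mul_le_self k D)).trans (key _ hN)
    have hN0 : (1 : ℝ) ≤ (k / D : ℕ) := by exact_mod_cast hN
    have h2 : ((k : ℝ) + 1) ≤ 2 * D * (k / D : ℕ) := by
      have h3 := Nat.lt_div_mul_add (a := k) (b := D) (by omega)
      have h4 : k + 1 ≤ 2 * D * (k / D) := by nlinarith
      exact_mod_cast h4
    have h5 : sVal A k * (k + 1) ≤ (R + 3) * (C / (k / D : ℕ)) * (2 * D * (k / D : ℕ)) :=
      mul_le_mul h1 h2 (by positivity) (by positivity)
    have h6 : (R + 3) * (C / (k / D : ℕ)) * (2 * D * (k / D : ℕ)) = (R + 3) * C * (2 * D) := by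
      field_simp
    have : 0 ≤ ‖A‖ * D := by positivity
    linarith

end KernelDecay

section HalfFourier

/-- Partial derivative in the frequency variable. -/
def dxi (ψ : ℝ × ℝ → ℝ) (p : ℝ × ℝ) : ℝ := fderiv ℝ ψ p (0, 1)

/-- Fourier transform in the frequency variable over the interval `(0, b)`. -/
def halfFourier (b : ℝ) (ψ : ℝ × ℝ → ℝ) (p : ℝ × ℝ) : ℂ :=
  ∫ ξ in (0 : ℝ)..b, Complex.exp (Complex.I * (p.2 * ξ : ℝ)) * ψ (p.1, ξ)

/-- Smooth functions supported in the open ball of radius `b`. -/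
structure IsBump (b : ℝ) (ψ : ℝ × ℝ → ℝ) : Prop where
  smooth : ContDiff ℝ (⊤ : ℕ∞) ψ
  supp : tsupport ψ ⊆ Metric.ball 0 b

variable {b : ℝ} {ψ : ℝ × ℝ → ℝ}

theorem IsBump.dxi (h : IsBump b ψ) : IsBump b (dxi ψ) where
  smooth := (h.smooth.fderiv_right (m := (⊤ : ℕ∞)) (by simp)).clm_apply contDiff_const
  supp := (tsupport_fderiv_apply_subset ℝ (0, 1)).trans h.supp

theorem IsBump.hasCompactSupport (h : IsBump b ψ) : HasCompactSupport ψ :=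
  (isCompact_closedBall 0 b).of_isClosed_subset (isClosed_tsupport ψ)
    (h.supp.trans Metric.ball_subset_closedBall)

theorem IsBump.eq_zero (h : IsBump b ψ) {p : ℝ × ℝ} (hp : b ≤ |p.1| ∨ b ≤ |p.2|) : ψ p = 0 := by
  refine image_eq_zero_of_notMem_tsupport fun hmem => ?_
  have h1 := h.supp hmem
  rw [mem_ball_zero_iff, Prod.norm_def, max_lt_iff, Real.norm_eq_abs, Real.norm_eq_abs] at h1
  rcases hp with hp | hp
  · exact absurd h1.1 (not_lt.2 hp)
  · exact absurd h1.2 (not_lt.2 hp)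

theorem IsBump.exists_bound (h : IsBump b ψ) : ∃ M, 0 ≤ M ∧ ∀ p, |ψ p| ≤ M := by
  obtain ⟨M, hM⟩ := h.hasCompactSupport.exists_bound_of_continuous h.smooth.continuous
  exact ⟨M, (norm_nonneg _).trans (hM 0), hM⟩

theorem IsBump.exists_lipschitz (h : IsBump b ψ) : ∃ L, LipschitzWith L ψ :=
  h.smooth.lipschitzWith_of_hasCompactSupport h.hasCompactSupport (by simp)

theorem IsBump.hasDerivAt (h : IsBump b ψ) (q ξ : ℝ) :
    HasDerivAt (fun ξ => ψ (q, ξ)) (_root_.dxi ψ (q, ξ)) ξ := by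
  have h1 := ((h.smooth.differentiable (by simp)) (q, ξ)).hasFDerivAt
  exact h1.comp_hasDerivAt ξ ((hasDerivAt_const ξ q).prodMk (hasDerivAt_id ξ))

theorem norm_exp_I_mul (a : ℝ) : ‖Complex.exp (Complex.I * a)‖ = 1 := by
  rw [mul_comm, Complex.norm_exp_ofReal_mul_I]

theorem IsBump.continuous_integrand (h : IsBump b ψ) (p : ℝ × ℝ) :
    Continuous fun ξ : ℝ => Complex.exp (Complex.I * (p.2 * ξ : ℝ)) * ψ (p.1, ξ) := by
  have := h.smooth.continuous
  fun_prop

theorem IsBump.exists_halfFourier_bound (h : IsBump b ψ) : ∃ M, 0 ≤ M ∧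
    ∀ p, ‖halfFourier b ψ p‖ ≤ M := by
  obtain ⟨M, hM0, hM⟩ := h.exists_bound
  refine ⟨M * |b - 0|, by positivity, fun p => ?_⟩
  refine intervalIntegral.norm_integral_le_of_norm_le_const fun ξ _ => ?_
  rw [norm_mul, norm_exp_I_mul, one_mul, Complex.norm_real]
  exact hM _

theorem norm_exp_sub_exp_le (s t : ℝ) :
    ‖Complex.exp (Complex.I * s) - Complex.exp (Complex.I * t)‖ ≤ |s - t| := by
  have h1 : Complex.exp (Complex.I * s) - Complex.exp (Complex.I * t) =
      Complex.exp (Complex.I * t) * (Complex.exp (Complex.I * (s - t : ℝ)) - 1) := by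
    rw [mul_sub, ← Complex.exp_add]
    push_cast
    ring_nf
  rw [h1, norm_mul, norm_exp_I_mul, one_mul]
  exact Real.norm_exp_I_mul_ofReal_sub_one_le

theorem IsBump.exists_halfFourier_lipschitz (h : IsBump b ψ) (hb : 0 ≤ b) :
    ∃ L, LipschitzWith L (halfFourier b ψ) := by
  obtain ⟨M, hM0, hM⟩ := h.exists_bound
  obtain ⟨L, hL⟩ := h.exists_lipschitz
  have hC : 0 ≤ (L + b * M) * |b - 0| := by positivity
  refine ⟨⟨_, hC⟩, LipschitzWith.of_dist_le_mul fun p p' => ?_⟩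
  rw [dist_eq_norm, halfFourier, halfFourier, ← intervalIntegral.integral_sub
    ((h.continuous_integrand p).intervalIntegrable _ _)
    ((h.continuous_integrand p').intervalIntegrable _ _)]
  have hd1 : |p.1 - p'.1| ≤ dist p p' := le_max_left _ _
  have hd2 : |p.2 - p'.2| ≤ dist p p' := le_max_right _ _
  have hbd : ∀ ξ ∈ Set.uIoc 0 b, ‖Complex.exp (Complex.I * (p.2 * ξ : ℝ)) * ψ (p.1, ξ) -
      Complex.exp (Complex.I * (p'.2 * ξ : ℝ)) * ψ (p'.1, ξ)‖ ≤ (L + b * M) * dist p p' := by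
    intro ξ hξ
    rw [Set.uIoc_of_le hb] at hξ
    have e : Complex.exp (Complex.I * (p.2 * ξ : ℝ)) * ψ (p.1, ξ) -
        Complex.exp (Complex.I * (p'.2 * ξ : ℝ)) * ψ (p'.1, ξ) =
        Complex.exp (Complex.I * (p.2 * ξ : ℝ)) * ((ψ (p.1, ξ) - ψ (p'.1, ξ) : ℝ) : ℂ) +
        (Complex.exp (Complex.I * (p.2 * ξ : ℝ)) - Complex.exp (Complex.I * (p'.2 * ξ : ℝ))) *
          ψ (p'.1, ξ) := by
      push_cast
      ring
    rw [e]
    refine (norm_add_le _ _).trans ?_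
    rw [norm_mul, norm_mul, norm_exp_I_mul, one_mul, Complex.norm_real, Complex.norm_real, add_mul]
    refine add_le_add ?_ ?_
    · have h1 := hL.dist_le_mul (p.1, ξ) (p'.1, ξ)
      rw [dist_eq_norm] at h1
      refine h1.trans (mul_le_mul_of_nonneg_left ?_ L.2)
      rw [Prod.dist_eq]
      simpa [Real.dist_eq] using hd1
    · have h1 : ‖Complex.exp (Complex.I * (p.2 * ξ : ℝ)) -
          Complex.exp (Complex.I * (p'.2 * ξ : ℝ))‖ ≤ b * dist p p' := by
        refine (norm_exp_sub_exp_le _ _).trans ?_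
        rw [← sub_mul, abs_mul, abs_of_pos hξ.1, mul_comm]
        exact mul_le_mul hξ.2 hd2 (abs_nonneg _) hb
      calc _ ≤ (b * dist p p') * M := mul_le_mul h1 (hM _) (abs_nonneg _) (by positivity)
        _ = b * M * dist p p' := by ring
  refine (intervalIntegral.norm_integral_le_of_norm_le_const hbd).trans (le_of_eq ?_)
  change _ = (L + b * M) * |b - 0| * dist p p'
  ring

theorem IsBump.halfFourier_parts (h : IsBump b ψ) (p : ℝ × ℝ) :
    Complex.I * p.2 * halfFourier b ψ p = -ψ (p.1, 0) - halfFourier b (_root_.dxi ψ) p := by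
  have hv : ∀ ξ : ℝ, HasDerivAt (fun ξ : ℝ => Complex.exp (Complex.I * (p.2 * ξ : ℝ)))
      (Complex.exp (Complex.I * (p.2 * ξ : ℝ)) * (Complex.I * p.2)) ξ := fun ξ => by
    have h1 : HasDerivAt (fun ξ : ℝ => Complex.I * (p.2 * ξ : ℝ)) (Complex.I * p.2) ξ := by
      have := ((hasDerivAt_id ξ).const_mul p.2).ofReal_comp.const_mul Complex.I
      simpa using this
    exact h1.cexp
  have hu : ∀ ξ : ℝ, HasDerivAt (fun ξ : ℝ => (ψ (p.1, ξ) : ℂ)) (_root_.dxi ψ (p.1, ξ) : ℂ) ξ :=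
    fun ξ => (h.hasDerivAt p.1 ξ).ofReal_comp
  have c1 : Continuous fun ξ : ℝ => (_root_.dxi ψ (p.1, ξ) : ℂ) := by
    have := h.dxi.smooth.continuous
    fun_prop
  have c2 : Continuous fun ξ : ℝ =>
      Complex.exp (Complex.I * (p.2 * ξ : ℝ)) * (Complex.I * p.2) := by fun_prop
  have hparts := intervalIntegral.integral_mul_deriv_eq_deriv_mul (a := 0) (b := b)
    (fun ξ _ => hu ξ) (fun ξ _ => hv ξ) (c1.intervalIntegrable _ _) (c2.intervalIntegrable _ _)
  have hb0 : ψ (p.1, b) = 0 := h.eq_zero (Or.inr (le_abs_self b))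
  rw [halfFourier, halfFourier, ← intervalIntegral.integral_const_mul]
  simp only [hb0, mul_zero, Complex.ofReal_zero, zero_mul, Complex.exp_zero, mul_one,
    zero_sub] at hparts
  convert hparts using 2
  · ext ξ
    ring
  · congr 1
    ext ξ
    ring

end HalfFourier

section StripKernels

/-- The kernel of the Weyl quantization of a symbol supported in the right half-plane, in terms of
the partial Fourier transform `κ` of the symbol. -/
def stripKernel (κ : ℝ × ℝ → ℂ) (x y : ℝ) : ℂ :=
  if 0 < x + y then κ ((x + y) / 2, x - y) else 0

theorem isStripKernel_of_factor {κ Θ : ℝ × ℝ → ℂ} {g : ℝ → ℂ} {G : ℝ → ℝ} {ω : ℤ → ℝ}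
    {R M : ℝ} {L : NNReal} (hκ : ∀ p, κ p = Θ p * g p.2) (hg : Continuous g)
    (hM : ∀ p, ‖Θ p‖ ≤ M) (hL : LipschitzWith L Θ)
    (hsupp : ∀ p : ℝ × ℝ, R ≤ 2 * p.1 → κ p = 0) (hgG : ∀ t, ‖g t‖ ≤ G t)
    (hgL : ∀ t t', ‖g t - g t'‖ ≤ |t - t'| * (G t + G t')) (hω : ∀ n, 0 ≤ ω n)
    (hGω : ∀ x y : ℝ, 0 < x + y → x + y < R + 1 → G (x - y) ≤ ω ⌊x⌋) :
    IsStripKernel (stripKernel κ) (fun n => (L + 2 * M) * ω n) R := by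
  have hM0 : 0 ≤ M := (norm_nonneg _).trans (hM 0)
  have hL0 : (0 : ℝ) ≤ L := L.2
  have hκc : Continuous κ := by
    rw [funext hκ]
    exact hL.continuous.mul (hg.comp continuous_snd)
  have hlarge : ∀ x y : ℝ, R ≤ x + y → stripKernel κ x y = 0 := fun x y h => by
    rw [stripKernel, hsupp _ (by simpa [mul_div_cancel₀] using h), ite_self]
  have hz : ∀ x : ℝ, 0 ≤ (L + 2 * M) * ω ⌊x⌋ := fun x => mul_nonneg (by positivity) (hω _)
  refine ⟨fun x => ?_, fun x y h => ?_, fun x y => ?_, fun x x' y hfl hx hx' hle => ?_⟩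
  · refine Measurable.ite (measurableSet_lt measurable_const (measurable_const_add x)) ?_
      measurable_const
    exact (hκc.comp (by fun_prop : Continuous fun y : ℝ => ((x + y) / 2, x - y))).measurable
  · by_cases h0 : 0 < x + y
    · exact hlarge x y (not_lt.1 fun h1 => h ⟨h0, h1⟩)
    · rw [stripKernel, if_neg h0]
  · by_cases h0 : 0 < x + y ∧ x + y < R
    · rw [stripKernel, if_pos h0.1, hκ, norm_mul]
      have h1 := (hgG (x - y)).trans (hGω x y h0.1 (by linarith [h0.2]))
      calc _ ≤ M * ω ⌊x⌋ := mul_le_mul (hM _) h1 (norm_nonneg _) hM0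
        _ ≤ _ := mul_le_mul_of_nonneg_right (by linarith) (hω _)
    · have : stripKernel κ x y = 0 := by
        by_cases h1 : 0 < x + y
        · exact hlarge x y (not_lt.1 fun h2 => h0 ⟨h1, h2⟩)
        · rw [stripKernel, if_neg h1]
      rw [this, norm_zero]
      exact hz x
  · by_cases hR : R ≤ x' + y
    · rw [hlarge x' y hR, hlarge x y (by linarith), sub_zero, norm_zero]
      exact mul_nonneg (hz x) (by linarith)
    · have hx1 : x < x' + 1 := by
        have h1 := Int.lt_floor_add_one x
        have h2 := Int.floor_le x'
        rw [hfl] at h2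
        linarith
      have g1 := hGω x y hx (by linarith)
      have g2 := hGω x' y hx' (by linarith)
      rw [hfl] at g2
      rw [stripKernel, if_pos hx, stripKernel, if_pos hx', hκ, hκ]
      dsimp only
      set p : ℝ × ℝ := ((x + y) / 2, x - y)
      set p' : ℝ × ℝ := ((x' + y) / 2, x' - y)
      have e : Θ p * g (x - y) - Θ p' * g (x' - y) =
          (Θ p - Θ p') * g (x - y) + Θ p' * (g (x - y) - g (x' - y)) := by ring
      have h1 : ‖Θ p - Θ p'‖ ≤ L * (x - x') := by
        have h2 := hL.dist_le_mul p p'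
        rw [dist_eq_norm] at h2
        refine h2.trans (mul_le_mul_of_nonneg_left ?_ hL0)
        rw [Prod.dist_eq, Real.dist_eq, Real.dist_eq]
        refine max_le ?_ ?_
        · rw [abs_le]
          constructor <;> simp only [p, p'] <;> linarith
        · rw [abs_le]
          constructor <;> simp only [p, p'] <;> linarith
      have h3 : ‖g (x - y) - g (x' - y)‖ ≤ (x - x') * (2 * ω ⌊x⌋) := by
        refine (hgL _ _).trans ?_
        have h4 : |x - y - (x' - y)| = x - x' := by
          rw [sub_sub_sub_cancel_right, abs_of_nonneg (by linarith)]
        rw [h4]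
        exact mul_le_mul_of_nonneg_left (by linarith) (by linarith)
      rw [e]
      refine (norm_add_le _ _).trans ?_
      rw [norm_mul, norm_mul]
      have h5 : ‖Θ p - Θ p'‖ * ‖g (x - y)‖ ≤ (L * (x - x')) * ω ⌊x⌋ :=
        mul_le_mul h1 ((hgG _).trans g1) (norm_nonneg _) (mul_nonneg hL0 (by linarith))
      have h6 : ‖Θ p'‖ * ‖g (x - y) - g (x' - y)‖ ≤ M * ((x - x') * (2 * ω ⌊x⌋)) :=
        mul_le_mul (hM _) h3 (norm_nonneg _) hM0
      calc _ ≤ _ := add_le_add h5 h6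
        _ = _ := by ring

theorem IsStripKernel.mono {K : ℝ → ℝ → ℂ} {w w' : ℤ → ℝ} {R : ℝ} (hK : IsStripKernel K w R)
    (hw : ∀ n, w n ≤ w' n) : IsStripKernel K w' R where
  measurable := hK.measurable
  supp := hK.supp
  bound x y := (hK.bound x y).trans (hw _)
  lipschitz x x' y h h1 h2 h3 := (hK.lipschitz x x' y h h1 h2 h3).trans
    (mul_le_mul_of_nonneg_right (hw _) (sub_nonneg.2 h3))

theorem one_add_floor_sq_le {R x y : ℝ} (h0 : 0 < x + y) (h1 : x + y < R + 1) :
    1 + (⌊x⌋ : ℝ) ^ 2 ≤ (1 + (R + 3) ^ 2) * (1 + (x - y) ^ 2) := by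
  have hf1 := Int.floor_le x
  have hf2 := Int.lt_floor_add_one x
  set n : ℝ := ((⌊x⌋ : ℤ) : ℝ)
  set t := x - y with ht
  have h2 : (2 * n) ^ 2 ≤ (|t| + (R + 3)) ^ 2 := by
    refine sq_le_sq' ?_ ?_
    · linarith [neg_abs_le t]
    · linarith [le_abs_self t]
  have h3 := sq_abs t
  have h4 := abs_nonneg t
  nlinarith [sq_nonneg (|t| - (R + 3)), mul_nonneg (sq_nonneg t) (sq_nonneg (R + 3))]

variable {b : ℝ} {φ : ℝ × ℝ → ℝ}

theorem halfFourier_eq_zero (h : IsBump b φ) {p : ℝ × ℝ} (hp : b ≤ p.1) :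
    halfFourier b φ p = 0 := by
  have : ∀ ξ : ℝ, φ (p.1, ξ) = 0 := fun ξ => h.eq_zero (Or.inl (hp.trans (le_abs_self _)))
  simp [halfFourier, this]

theorem isStripKernel_halfFourier (h : IsBump b φ) (hb : 0 ≤ b) (c : ℝ) :
    ∃ w : ℤ → ℝ, (∀ n, 0 ≤ w n) ∧ Tendsto w cofinite (nhds 0) ∧
      IsStripKernel (stripKernel fun p => c * halfFourier b φ p) w (2 * b) := by
  let Θ : ℝ × ℝ → ℂ := fun p =>
    c * (halfFourier b φ p + (φ (p.1, 0) + halfFourier b (dxi φ) p))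
  let g : ℝ → ℂ := fun t => (1 - Complex.I * t)⁻¹
  have hden : ∀ t : ℝ, (1 - Complex.I * t) ≠ 0 := fun t ht => by
    have := congrArg Complex.re ht
    simp at this
  have hnorm : ∀ t : ℝ, ‖1 - Complex.I * t‖ = Real.sqrt (1 + t ^ 2) := fun t => by
    rw [Complex.norm_def, Complex.normSq_apply]
    simp
    ring_nf
  let G : ℝ → ℝ := fun t => (Real.sqrt (1 + t ^ 2))⁻¹
  have hgG : ∀ t, ‖g t‖ = G t := fun t => by rw [norm_inv, hnorm]
  have hG1 : ∀ t, G t ≤ 1 := fun t => inv_le_one_of_one_le₀ (by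
    rw [Real.one_le_sqrt]; nlinarith)
  have hG0 : ∀ t, 0 ≤ G t := fun t => by positivity
  obtain ⟨M₁, hM₁0, hM₁⟩ := h.exists_halfFourier_bound
  obtain ⟨M₂, hM₂0, hM₂⟩ := h.exists_bound
  obtain ⟨M₃, hM₃0, hM₃⟩ := h.dxi.exists_halfFourier_bound
  obtain ⟨L₁, hL₁⟩ := h.exists_halfFourier_lipschitz hb
  obtain ⟨L₂, hL₂⟩ := h.exists_lipschitz
  obtain ⟨L₃, hL₃⟩ := h.dxi.exists_halfFourier_lipschitz hb
  have hΘL : LipschitzWith (‖(c : ℂ)‖₊ * (L₁ + (1 * (L₂ * (1 * 1)) + L₃))) Θ := by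
    have hφ0 : LipschitzWith (1 * (L₂ * (1 * 1))) fun p : ℝ × ℝ => (φ (p.1, 0) : ℂ) :=
      Complex.isometry_ofReal.lipschitz.comp (hL₂.comp
        ((LipschitzWith.prodMk_right (0 : ℝ)).comp LipschitzWith.prod_fst))
    exact (lipschitzWith_smul (c : ℂ)).comp (hL₁.add (hφ0.add hL₃))
  have hΘM : ∀ p, ‖Θ p‖ ≤ |c| * (M₁ + (M₂ + M₃)) := fun p => by
    simp only [Θ]
    rw [norm_mul, Complex.norm_real]
    refine mul_le_mul_of_nonneg_left ?_ (abs_nonneg c)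
    refine (norm_add_le _ _).trans (add_le_add (hM₁ p) ((norm_add_le _ _).trans
      (add_le_add ?_ (hM₃ p))))
    rw [Complex.norm_real]
    exact hM₂ _
  set ω : ℤ → ℝ := fun n => Real.sqrt ((1 + (2 * b + 3) ^ 2) * (1 / (1 + (n : ℝ) ^ 2)))
  have hmain := isStripKernel_of_factor (κ := fun p => c * halfFourier b φ p) (Θ := Θ) (g := g)
    (G := G) (ω := ω) (R := 2 * b) ?_ ?_ hΘM hΘL ?_ (fun t => (hgG t).le) ?_
    (fun n => Real.sqrt_nonneg _) ?_
  · refine ⟨_, fun n => ?_, ?_, hmain⟩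
    · positivity
    · have h1 := summable_inv_one_add_sq.tendsto_cofinite_zero
      have h2 := (h1.const_mul (1 + (2 * b + 3) ^ 2)).sqrt
      simpa only [mul_zero, Real.sqrt_zero] using h2.const_mul _
  · intro p
    simp only [Θ, g]
    rw [eq_mul_inv_iff_mul_eq₀ (hden _)]
    linear_combination (-c : ℂ) * h.halfFourier_parts p
  · exact Continuous.inv₀ (by fun_prop) hden
  · intro p hp
    rw [halfFourier_eq_zero h (by linarith), mul_zero]
  · intro t t'
    have e : g t - g t' = Complex.I * (t - t') * (g t * g t') := by
      simp only [g]
      field_simp [hden t, hden t']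
      ring
    rw [e, norm_mul, norm_mul, norm_mul, Complex.norm_I, one_mul, hgG, hgG, ← Complex.ofReal_sub,
      Complex.norm_real, Real.norm_eq_abs]
    refine mul_le_mul_of_nonneg_left ?_ (abs_nonneg _)
    nlinarith [hG1 t, hG0 t, hG0 t']
  · intro x y h0 h1
    have h2 := one_add_floor_sq_le h0 h1
    simp only [G, ω]
    rw [← Real.sqrt_inv]
    refine Real.sqrt_le_sqrt ?_
    rw [mul_one_div, inv_eq_one_div, div_le_div_iff₀ (by positivity) (by positivity), one_mul]
    exact h2

theorem isStripKernel_re_halfFourier (h : IsBump b φ) (hb : 0 ≤ b) (c : ℝ) :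
    ∃ C : ℝ, 0 < C ∧ IsStripKernel (stripKernel fun p => ((c * (halfFourier b φ p).re : ℝ) : ℂ))
      (fun n => C / (1 + (n : ℝ) ^ 2)) (2 * b) := by
  let θ : ℝ × ℝ → ℝ := fun p => c * ((halfFourier b φ p).re +
    (-dxi φ (p.1, 0) + -(halfFourier b (dxi (dxi φ)) p).re))
  let Θ : ℝ × ℝ → ℂ := fun p => (θ p : ℂ)
  let G : ℝ → ℝ := fun t => (1 + t ^ 2)⁻¹
  let g : ℝ → ℂ := fun t => (G t : ℂ)
  have hG0 : ∀ t, 0 < G t := fun t => by positivity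
  have hgG : ∀ t, ‖g t‖ = G t := fun t => by
    rw [Complex.norm_real, Real.norm_of_nonneg (hG0 t).le]
  obtain ⟨M₁, hM₁0, hM₁⟩ := h.exists_halfFourier_bound
  obtain ⟨M₂, hM₂0, hM₂⟩ := h.dxi.exists_bound
  obtain ⟨M₃, hM₃0, hM₃⟩ := h.dxi.dxi.exists_halfFourier_bound
  obtain ⟨L₁, hL₁⟩ := h.exists_halfFourier_lipschitz hb
  obtain ⟨L₂, hL₂⟩ := h.dxi.exists_lipschitz
  obtain ⟨L₃, hL₃⟩ := h.dxi.dxi.exists_halfFourier_lipschitz hb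
  have hre : LipschitzWith 1 Complex.re := by
    refine LipschitzWith.of_dist_le_mul fun z w => ?_
    rw [NNReal.coe_one, one_mul, Real.dist_eq, ← Complex.sub_re, dist_eq_norm]
    exact Complex.abs_re_le_norm _
  have hΘL : LipschitzWith (1 * (‖c‖₊ * (1 * L₁ + (L₂ * (1 * 1) + 1 * L₃)))) Θ := by
    have hφ0 : LipschitzWith (L₂ * (1 * 1)) fun p : ℝ × ℝ => -dxi φ (p.1, 0) :=
      (hL₂.comp ((LipschitzWith.prodMk_right (0 : ℝ)).comp LipschitzWith.prod_fst)).neg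
    exact Complex.isometry_ofReal.lipschitz.comp ((lipschitzWith_smul c).comp
      ((hre.comp hL₁).add (hφ0.add (hre.comp hL₃).neg)))
  have hΘM : ∀ p, ‖Θ p‖ ≤ |c| * (M₁ + (M₂ + M₃)) := fun p => by
    simp only [Θ, θ]
    rw [Complex.norm_real, norm_mul]
    refine mul_le_mul_of_nonneg_left ?_ (abs_nonneg c)
    refine (norm_add_le _ _).trans (add_le_add ((Complex.abs_re_le_norm _).trans (hM₁ p))
      ((norm_add_le _ _).trans (add_le_add ?_ ?_)))
    · rw [norm_neg]
      exact hM₂ _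
    · rw [norm_neg]
      exact (Complex.abs_re_le_norm _).trans (hM₃ p)
  set ω : ℤ → ℝ := fun n => (1 + (2 * b + 3) ^ 2) / (1 + (n : ℝ) ^ 2)
  have hmain := isStripKernel_of_factor
    (κ := fun p => ((c * (halfFourier b φ p).re : ℝ) : ℂ)) (Θ := Θ) (g := g)
    (G := G) (ω := ω) (R := 2 * b) ?_ ?_ hΘM hΘL ?_ (fun t => (hgG t).le) ?_
    (fun n => by positivity) ?_
  · obtain ⟨A, hA0, hA⟩ : ∃ A : ℝ, 0 ≤ A ∧ IsStripKernel
        (stripKernel fun p => ((c * (halfFourier b φ p).re : ℝ) : ℂ)) (fun n => A * ω n) (2 * b) :=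
      ⟨_, by positivity, hmain⟩
    refine ⟨A * (1 + (2 * b + 3) ^ 2) + 1, by positivity, hA.mono fun n => ?_⟩
    simp only [ω]
    rw [← mul_div_assoc]
    gcongr
    exact (lt_add_one _).le
  · intro p
    simp only [Θ, g, G]
    rw [← Complex.ofReal_mul, Complex.ofReal_inj, eq_mul_inv_iff_mul_eq₀ (by positivity)]
    have h1 := h.halfFourier_parts p
    have h2 := h.dxi.halfFourier_parts p
    have h3 : (p.2 : ℂ) ^ 2 * halfFourier b φ p = Complex.I * p.2 * φ (p.1, 0) -
        dxi φ (p.1, 0) - halfFourier b (dxi (dxi φ)) p := by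
      linear_combination (-Complex.I * p.2) * h1 + h2 + p.2 ^ 2 * halfFourier b φ p * Complex.I_sq
    have h4 := congrArg Complex.re h3
    rw [← Complex.ofReal_pow, Complex.re_ofReal_mul] at h4
    simp only [Complex.sub_re, Complex.mul_re, Complex.I_re, Complex.ofReal_re, Complex.I_im,
      Complex.ofReal_im, Complex.mul_im] at h4
    simp only [θ]
    linear_combination c * h4
  · exact Complex.continuous_ofReal.comp (Continuous.inv₀ (by fun_prop) fun t => by positivity)
  · intro p hp
    rw [halfFourier_eq_zero h (by linarith)]
    simp
  · intro t t'
    have e : G t - G t' = (t' - t) * ((t' + t) * (G t * G t')) := by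
      simp only [G]
      field_simp
      ring
    have ha : ∀ t, |t| * G t ≤ 1 := fun t => by
      simp only [G]
      rw [mul_inv_le_iff₀ (by positivity)]
      nlinarith [sq_abs t, sq_nonneg (|t| - 1)]
    simp only [g]
    rw [← Complex.ofReal_sub, Complex.norm_real, e, norm_mul, norm_mul, Real.norm_eq_abs,
      abs_sub_comm t' t, Real.norm_eq_abs, Real.norm_of_nonneg (by positivity)]
    refine mul_le_mul_of_nonneg_left ?_ (abs_nonneg _)
    calc |t' + t| * (G t * G t') ≤ (|t'| + |t|) * (G t * G t') :=
          mul_le_mul_of_nonneg_right (abs_add_le _ _) (by positivity)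
      _ = (|t'| * G t') * G t + (|t| * G t) * G t' := by ring
      _ ≤ 1 * G t + 1 * G t' := by
          gcongr <;> apply ha
      _ = _ := by ring
  · intro x y h0 h1
    have h2 := one_add_floor_sq_le h0 h1
    simp only [G, ω]
    rw [inv_eq_one_div, div_le_div_iff₀ (by positivity) (by positivity), one_mul]
    exact h2

end StripKernels

section Conjugation

/-- Conjugation by an antiunitary involution does not increase the eigenvalues. -/
theorem eigPlus_conj_le {E : Type*} [NormedAddCommGroup E] [InnerProductSpace ℂ E]
    (hE : ¬ FiniteDimensional ℂ E) (J : E →SL[starRingEnd ℂ] E) (hJ : ∀ u, J (J u) = u)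
    (hin : ∀ u v, ⟪J u, J v⟫_ℂ = ⟪v, u⟫_ℂ) (A : E →L[ℂ] E) (k : ℕ) :
    eigPlus (J.comp (A.comp J)) k ≤ eigPlus A k := by
  refine le_of_forall_gt_imp_ge_of_dense fun c hc => ?_
  obtain ⟨V, hV, hVc⟩ := exists_of_eigPlus_lt A hc
  let W : Submodule ℂ E := V.comap (J : E →ₛₗ[starRingEnd ℂ] E)
  have hW : Module.rank ℂ W ≤ (k : Cardinal) := by
    refine le_trans ?_ hV
    let j : W →+ V :=
      { toFun := fun w => ⟨J w.1, w.2⟩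
        map_zero' := by ext; simp
        map_add' := fun a b => by ext; simp }
    refine rank_le_of_surjective_injective (starRingEnd ℂ) j (star_involutive).surjective
      (fun a b hab => ?_) (fun r m => ?_)
    · have h1 : J a.1 = J b.1 := congrArg Subtype.val hab
      ext
      rw [← hJ a.1, h1, hJ]
    · ext
      exact map_smulₛₗ J r m.1
  refine eigPlus_le hE _ hW fun u hu hu1 => ?_
  have h1 : J u ∈ Vᗮ := fun v hv => by
    have h2 : J v ∈ W := by
      change J (J v) ∈ V
      rwa [hJ]
    have h3 := hu (J v) h2
    rw [← hJ v, hin, ← inner_conj_symm, h3, map_zero]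
  have h2 : ‖J u‖ = 1 := by
    rw [← hu1, norm_eq_sqrt_re_inner (𝕜 := ℂ), hin, ← norm_eq_sqrt_re_inner]
  have h3 : (⟪J (A (J u)), u⟫_ℂ).re = (⟪A (J u), J u⟫_ℂ).re := by
    conv_lhs => rw [← hJ u, hJ, hin]
    rw [← inner_conj_symm, Complex.conj_re]
  change (⟪J (A (J u)), u⟫_ℂ).re ≤ c
  rw [h3]
  exact hVc _ h1 h2

/-- Pointwise complex conjugation on `L²(ℝ)`. -/
def conjL2 : L2R →SL[starRingEnd ℂ] L2R :=
  ((starL ℂ : ℂ ≃L⋆[ℂ] ℂ) : ℂ →L⋆[ℂ] ℂ).compLpL 2 volume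

theorem coeFn_conjL2 (f : L2R) : conjL2 f =ᵐ[volume] fun x => (starRingEnd ℂ) (f x) :=
  ContinuousLinearMap.coeFn_compLpL _ f

theorem conjL2_conjL2 (f : L2R) : conjL2 (conjL2 f) = f := by
  ext1
  filter_upwards [coeFn_conjL2 f, coeFn_conjL2 (conjL2 f)] with x h1 h2
  rw [h2, h1, Complex.conj_conj]

theorem inner_conjL2 (f g : L2R) : ⟪conjL2 f, conjL2 g⟫_ℂ = ⟪g, f⟫_ℂ := by
  rw [L2.inner_def, L2.inner_def]
  refine integral_congr_ae ?_
  filter_upwards [coeFn_conjL2 f, coeFn_conjL2 g] with x h1 h2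
  rw [h1, h2, RCLike.inner_apply, RCLike.inner_apply, Complex.conj_conj, mul_comm]

/-- Complex conjugation of a Schwartz function. -/
def conjSchwartz (u : SchwartzMap ℝ ℂ) : SchwartzMap ℝ ℂ :=
  u.postcompCLM (Complex.conjCLE : ℂ →L[ℝ] ℂ)

theorem conjSchwartz_apply (u : SchwartzMap ℝ ℂ) (x : ℝ) :
    conjSchwartz u x = (starRingEnd ℂ) (u x) := rfl

theorem conjL2_toLp (u : SchwartzMap ℝ ℂ) :
    conjL2 (u.toLp 2 volume) = (conjSchwartz u).toLp 2 volume := by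
  ext1
  filter_upwards [coeFn_conjL2 (u.toLp 2 volume), SchwartzMap.coeFn_toLp u 2 volume,
    SchwartzMap.coeFn_toLp (conjSchwartz u) 2 volume] with x h1 h2 h3
  rw [h1, h2, h3, conjSchwartz_apply]

theorem HasKernel.conj {A : L2R →L[ℂ] L2R} {K : ℝ → ℝ → ℂ} (h : HasKernel A K) :
    HasKernel (conjL2.comp (A.comp conjL2)) fun x y => (starRingEnd ℂ) (K x y) := by
  intro u
  have h1 := h (conjSchwartz u)
  rw [← conjL2_toLp] at h1
  filter_upwards [h1, coeFn_conjL2 (A (conjL2 (u.toLp 2 volume)))] with x h2 h3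
  change conjL2 (A (conjL2 (u.toLp 2 volume))) x = _
  rw [h3, h2, ← integral_conj]
  simp only [map_mul, conjSchwartz_apply, Complex.conj_conj]

theorem HasKernel.add {A B : L2R →L[ℂ] L2R} {K K' : ℝ → ℝ → ℂ} (h : HasKernel A K)
    (h' : HasKernel B K') (hK : ∀ x (u : SchwartzMap ℝ ℂ), Integrable fun y => K x y * u y)
    (hK' : ∀ x (u : SchwartzMap ℝ ℂ), Integrable fun y => K' x y * u y) :
    HasKernel (A + B) fun x y => K x y + K' x y := by
  intro u
  filter_upwards [h u, h' u, Lp.coeFn_add (A (u.toLp 2 volume)) (B (u.toLp 2 volume))]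
    with x h1 h2 h3
  rw [add_apply, h3, Pi.add_apply, h1, h2, ← integral_add (hK x u) (hK' x u)]
  simp only [add_mul]

theorem HasKernel.isSymmetric {A : L2R →L[ℂ] L2R} {K : ℝ → ℝ → ℂ} (h : HasKernel A K)
    (hm : Measurable (Function.uncurry K)) {M : ℝ} (hM : ∀ x y, ‖K x y‖ ≤ M)
    (hsym : ∀ x y, K y x = (starRingEnd ℂ) (K x y)) : (A : L2R →ₗ[ℂ] L2R).IsSymmetric := by
  intro f g
  change ⟪A f, g⟫_ℂ = ⟪f, A g⟫_ℂ
  refine dense_schwartz.induction_on₂ (p := fun f g => ⟪A f, g⟫_ℂ = ⟪f, A g⟫_ℂ) ?_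
    (fun u v => ?_) f g
  · exact isClosed_eq (by fun_prop) (by fun_prop)
  · have e1 : ⟪A (u.toLp 2 volume), (v.toLp 2 volume : L2R)⟫_ℂ =
        ∫ x, ∫ y, (starRingEnd ℂ) (K x y) * ((starRingEnd ℂ) (u y) * v x) := by
      rw [L2.inner_def]
      refine integral_congr_ae ?_
      filter_upwards [h u, SchwartzMap.coeFn_toLp v 2 volume] with x h1 h2
      rw [h1, h2, RCLike.inner_apply, mul_comm, ← integral_conj, ← integral_mul_const]
      refine integral_congr_ae (Eventually.of_forall fun y => ?_)
      simp only [map_mul]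
      ring
    have e2 : ⟪(u.toLp 2 volume : L2R), A (v.toLp 2 volume)⟫_ℂ =
        ∫ y, ∫ x, (starRingEnd ℂ) (K x y) * ((starRingEnd ℂ) (u y) * v x) := by
      rw [L2.inner_def]
      refine integral_congr_ae ?_
      filter_upwards [h v, SchwartzMap.coeFn_toLp u 2 volume] with y h1 h2
      rw [h1, h2, RCLike.inner_apply, ← integral_mul_const]
      refine integral_congr_ae (Eventually.of_forall fun x => ?_)
      simp only [hsym x y]
      ring
    rw [e1, e2]
    refine integral_integral_swap (f := fun x y =>
      (starRingEnd ℂ) (K x y) * ((starRingEnd ℂ) (u y) * v x)) ?_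
    have hint : Integrable (fun p : ℝ × ℝ => v p.1 * (conjSchwartz u) p.2)
        (volume.prod volume) := v.integrable.mul_prod (conjSchwartz u).integrable
    have h2 : Integrable (fun p : ℝ × ℝ => (starRingEnd ℂ) (K p.1 p.2) *
        (v p.1 * (conjSchwartz u) p.2)) (volume.prod volume) :=
      hint.bdd_mul (c := M) (Complex.continuous_conj.measurable.comp hm).aestronglyMeasurable
        (Eventually.of_forall fun p => by rw [RCLike.norm_conj]; exact hM _ _)
    refine h2.congr (Eventually.of_forall fun p => ?_)
    simp only [Function.uncurry, conjSchwartz_apply]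
    ring

end Conjugation

section Weyl

theorem sector_quarter : sector (Real.pi / 2) = Set.Ioi 0 ×ˢ Set.Ioi 0 := by
  ext ⟨x, ξ⟩
  have hre : ((x : ℂ) + ξ * Complex.I).re = x := by simp
  have him : ((x : ℂ) + ξ * Complex.I).im = ξ := by simp
  have hpi := Real.pi_pos
  change (0 < arg2pi ((x : ℂ) + ξ * Complex.I) ∧
    arg2pi ((x : ℂ) + ξ * Complex.I) < Real.pi / 2) ↔ _
  set z : ℂ := (x : ℂ) + ξ * Complex.I
  rw [Set.mem_prod, Set.mem_Ioi, Set.mem_Ioi, arg2pi]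
  dsimp only
  have h1 := Complex.abs_arg_lt_pi_div_two_iff (z := z)
  have h2 := Complex.arg_nonneg_iff (z := z)
  have h3 := Complex.arg_eq_zero_iff (z := z)
  have h4 := Complex.neg_pi_lt_arg z
  rw [hre] at h1 h3
  rw [him] at h2 h3
  split_ifs with h
  · constructor
    · rintro ⟨ha, hb⟩
      have h5 : z ≠ 0 := fun hz => by simp [hz] at ha
      have hx : 0 < x := by
        rcases h1.1 (by rw [abs_of_pos ha]; exact hb) with h6 | h6
        · exact h6
        · exact absurd h6 h5
      refine ⟨hx, lt_of_le_of_ne (h2.1 h) fun h6 => ha.ne' (h3.2 ⟨hx.le, h6.symm⟩)⟩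
    · rintro ⟨hx, hξ⟩
      refine ⟨lt_of_le_of_ne h fun h6 => hξ.ne' (h3.1 h6.symm).2, ?_⟩
      exact (le_abs_self _).trans_lt (h1.2 (Or.inl hx))
  · constructor
    · rintro ⟨-, hb⟩
      linarith
    · rintro ⟨-, hξ⟩
      exact absurd (h2.2 hξ.le) h

variable {b : ℝ} {φ : ℝ × ℝ → ℝ}

theorem norm_symbAOm_le {Ω : Set (ℝ × ℝ)} {M : ℝ} (h : IsBump b φ) (hM : ∀ p, |φ p| ≤ M)
    (q ξ : ℝ) :
    ‖symbAOm Ω φ (q, ξ)‖ ≤ (Set.Ioo (-b) b).indicator (fun _ => M) ξ := by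
  have h1 : ‖symbAOm Ω φ (q, ξ)‖ ≤ |φ (q, ξ)| := by
    refine (norm_indicator_le_norm_self _ _).trans ?_
    rw [Complex.norm_real, Real.norm_eq_abs]
  refine h1.trans ?_
  by_cases hξ : ξ ∈ Set.Ioo (-b) b
  · rw [Set.indicator_of_mem hξ]
    exact hM _
  · rw [Set.indicator_of_notMem hξ, h.eq_zero (Or.inr (not_lt.1 fun h2 => hξ (abs_lt.1 h2))),
      abs_zero]

theorem integral_symbAOm (h : IsBump b φ) (hb : 0 ≤ b) (q t : ℝ) :
    ∫ ξ : ℝ, Complex.exp (Complex.I * (t * ξ : ℝ)) * symbAOm (Set.Ioi 0 ×ˢ Set.Ioi 0) φ (q, ξ) =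
      if 0 < q then halfFourier b φ (q, t) else 0 := by
  have hb0 : ∀ ξ, b ≤ ξ → φ (q, ξ) = 0 := fun ξ hξ => h.eq_zero (Or.inr (hξ.trans (le_abs_self _)))
  split_ifs with hq
  · have hpt : ∀ ξ, Complex.exp (Complex.I * (t * ξ : ℝ)) *
        symbAOm (Set.Ioi 0 ×ˢ Set.Ioi 0) φ (q, ξ) = (Set.Ioc 0 (b)).indicator
          (fun ξ : ℝ => Complex.exp (Complex.I * (t * ξ : ℝ)) * φ (q, ξ)) ξ := fun ξ => by
      by_cases hξ : 0 < ξ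
      · by_cases hξb : ξ ≤ b
        · rw [Set.indicator_of_mem (show ξ ∈ Set.Ioc 0 (b) from ⟨hξ, hξb⟩), symbAOm,
            Set.indicator_of_mem (show ((q, ξ) : ℝ × ℝ) ∈ Set.Ioi (0 : ℝ) ×ˢ Set.Ioi (0 : ℝ) from ⟨hq, hξ⟩)]
        · rw [Set.indicator_of_notMem (fun h' => hξb h'.2), symbAOm,
            Set.indicator_of_mem (show ((q, ξ) : ℝ × ℝ) ∈ Set.Ioi (0 : ℝ) ×ˢ Set.Ioi (0 : ℝ) from ⟨hq, hξ⟩),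
            hb0 ξ (not_le.1 hξb).le]
          simp
      · rw [Set.indicator_of_notMem (fun h' => hξ h'.1), symbAOm,
          Set.indicator_of_notMem (fun h' => hξ h'.2), mul_zero]
    simp only [hpt]
    rw [integral_indicator measurableSet_Ioc, halfFourier, intervalIntegral.integral_of_le hb]
  · have hpt : ∀ ξ, symbAOm (Set.Ioi 0 ×ˢ Set.Ioi 0) φ (q, ξ) = 0 := fun ξ =>
      Set.indicator_of_notMem (fun h' => hq h'.1) _
    simp [hpt]

theorem integrable_weyl_integrand {Ω : Set (ℝ × ℝ)} (hΩ : MeasurableSet Ω) (h : IsBump b φ)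
    (u : SchwartzMap ℝ ℂ) (x : ℝ) :
    Integrable (Function.uncurry fun ξ y : ℝ => Complex.exp (Complex.I * ((x - y) * ξ : ℝ)) *
      symbAOm Ω φ ((x + y) / 2, ξ) * u y) (volume.prod volume) := by
  obtain ⟨M, hM0, hM⟩ := h.exists_bound
  have hφ := h.smooth.continuous
  have hsm : Measurable (symbAOm Ω φ) :=
    (Complex.measurable_ofReal.comp hφ.measurable).indicator hΩ
  have hmeas : Measurable (Function.uncurry fun ξ y : ℝ =>
      Complex.exp (Complex.I * ((x - y) * ξ : ℝ)) * symbAOm Ω φ ((x + y) / 2, ξ) * u y) := by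
    refine Measurable.mul (Measurable.mul ?_ ?_) ?_
    · exact (by fun_prop : Continuous fun p : ℝ × ℝ =>
        Complex.exp (Complex.I * ((x - p.2) * p.1 : ℝ))).measurable
    · exact hsm.comp (by fun_prop : Measurable fun p : ℝ × ℝ => ((x + p.2) / 2, p.1))
    · exact u.continuous.measurable.comp measurable_snd
  have hdom : Integrable (fun p : ℝ × ℝ => (Set.Ioo (-b) b).indicator (fun _ => M) p.1 * ‖u p.2‖)
      (volume.prod volume) := by
    refine Integrable.mul_prod ?_ u.integrable.norm
    exact (integrable_indicator_iff measurableSet_Ioo).2 (integrableOn_const (by simp))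
  refine hdom.mono' hmeas.aestronglyMeasurable (Eventually.of_forall fun p => ?_)
  rw [Function.uncurry, norm_mul, norm_mul, norm_exp_I_mul, one_mul]
  exact mul_le_mul_of_nonneg_right (norm_symbAOm_le h hM _ _) (norm_nonneg _)

/-- The integral kernel of the Weyl quantization of the quarter-plane symbol. -/
theorem hasKernel_of_isWeylOp (h : IsBump b φ) (hb : 0 ≤ b) {T : L2R →L[ℂ] L2R}
    (hT : IsWeylOp (symbAOm (sector (Real.pi / 2)) φ) T) :
    HasKernel T (stripKernel fun p => ((2 * Real.pi)⁻¹ : ℝ) * halfFourier b φ p) := by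
  intro u
  filter_upwards [hT u _ (SchwartzMap.coeFn_toLp u 2 volume)] with x hx
  rw [hx, weylIntegral, sector_quarter, integral_integral_swap (integrable_weyl_integrand
    (measurableSet_Ioi.prod measurableSet_Ioi) h u x), ← integral_const_mul]
  refine integral_congr_ae (Eventually.of_forall fun y => ?_)
  dsimp only
  rw [integral_mul_const, integral_symbAOm h hb, stripKernel]
  by_cases hxy : 0 < x + y
  · rw [if_pos hxy, if_pos (by linarith)]
    ring
  · rw [if_neg hxy, if_neg (by intro h'; linarith)]
    ring

theorem not_finiteDimensional_L2R : ¬ FiniteDimensional ℂ L2R := by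
  intro hfin
  let e : ℕ → L2R := fun n => indicatorConstLp 2 (measurableSet_Ico (a := (n : ℝ)) (b := n + 1))
    measure_Ico_lt_top.ne 1
  have he : Orthonormal ℂ e := by
    rw [orthonormal_iff_ite]
    intro i j
    simp only [e]
    rw [L2.inner_indicatorConstLp_one_indicatorConstLp_one _ _ measure_Ico_lt_top.ne
      measure_Ico_lt_top.ne]
    split_ifs with hij
    · subst hij
      rw [Set.inter_self, Real.volume_real_Ico]
      simp
    · have hd : Set.Ico (i : ℝ) (i + 1) ∩ Set.Ico (j : ℝ) (j + 1) = ∅ := by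
        refine Set.eq_empty_of_forall_notMem fun x hx => hij ?_
        obtain ⟨⟨h1, h2⟩, h3, h4⟩ := hx
        have h5 : i < j + 1 := by exact_mod_cast h1.trans_lt h4
        have h6 : j < i + 1 := by exact_mod_cast h3.trans_lt h2
        omega
      rw [hd]
      simp
  exact Module.Finite.not_linearIndependent_of_infinite e he.linearIndependent

end Weyl

section SpectralSymmetry

variable {b : ℝ} {φ : ℝ × ℝ → ℝ}

theorem conj_halfFourier (q t : ℝ) :
    (starRingEnd ℂ) (halfFourier b φ (q, t)) = halfFourier b φ (q, -t) := by
  rw [halfFourier, halfFourier, ← intervalIntegral.intervalIntegral_conj]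
  refine intervalIntegral.integral_congr fun ξ _ => ?_
  simp only [map_mul, ← Complex.exp_conj, Complex.conj_ofReal, Complex.conj_I]
  congr 2
  push_cast
  ring

theorem measurable_stripKernel {κ : ℝ × ℝ → ℂ} (hκ : Measurable κ) :
    Measurable (Function.uncurry (stripKernel κ)) := by
  refine Measurable.ite (measurableSet_lt measurable_const (by fun_prop)) ?_ measurable_const
  exact hκ.comp (by fun_prop : Measurable fun p : ℝ × ℝ => ((p.1 + p.2) / 2, p.1 - p.2))

theorem stripKernel_hermitian (c x y : ℝ) :
    stripKernel (fun p => c * halfFourier b φ p) y x =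
      (starRingEnd ℂ) (stripKernel (fun p => c * halfFourier b φ p) x y) := by
  rw [stripKernel, stripKernel, apply_ite (starRingEnd ℂ), map_zero, map_mul, conj_halfFourier,
    Complex.conj_ofReal, neg_sub, add_comm y x]

theorem isSymmetric_of_isWeylOp (h : IsBump b φ) (hb : 0 ≤ b) {T : L2R →L[ℂ] L2R}
    (hT : IsWeylOp (symbAOm (sector (Real.pi / 2)) φ) T) :
    (T : L2R →ₗ[ℂ] L2R).IsSymmetric := by
  obtain ⟨M, hM0, hM⟩ := h.exists_halfFourier_bound
  obtain ⟨L, hL⟩ := h.exists_halfFourier_lipschitz hb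
  refine (hasKernel_of_isWeylOp h hb hT).isSymmetric (measurable_stripKernel ?_)
    (M := ‖(((2 * Real.pi)⁻¹ : ℝ) : ℂ)‖ * M) (fun x y => ?_) (stripKernel_hermitian _)
  · exact (hL.continuous.const_mul _).measurable
  · rw [stripKernel]
    split_ifs
    · rw [norm_mul]
      exact mul_le_mul_of_nonneg_left (hM _) (norm_nonneg _)
    · rw [norm_zero]
      positivity

theorem exists_sVal_lt_of_isWeylOp (h : IsBump b φ) (hb : 0 ≤ b) {T : L2R →L[ℂ] L2R}
    (hT : IsWeylOp (symbAOm (sector (Real.pi / 2)) φ) T) : ∀ ε > 0, ∃ n, sVal T n < ε := by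
  intro ε hε
  obtain ⟨w, hw, hw0, hK⟩ := isStripKernel_halfFourier h hb (2 * Real.pi)⁻¹
  exact exists_sVal_lt_of_stripKernel (hasKernel_of_isWeylOp h hb hT) hK (by positivity) hw hw0 hε

/-- The real part of the operator has singular values of order `1 / k`. -/
theorem exists_sVal_add_conj_le (h : IsBump b φ) (hb : 0 ≤ b) {T : L2R →L[ℂ] L2R}
    (hT : IsWeylOp (symbAOm (sector (Real.pi / 2)) φ) T) :
    ∃ C, 0 ≤ C ∧ ∀ k : ℕ, sVal (T + conjL2.comp (T.comp conjL2)) k ≤ C / (k + 1) := by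
  have hK := hasKernel_of_isWeylOp h hb hT
  obtain ⟨w, -, -, hstrip⟩ := isStripKernel_halfFourier h hb (2 * Real.pi)⁻¹
  obtain ⟨C, hC, hstrip'⟩ := isStripKernel_re_halfFourier h hb (2 * (2 * Real.pi)⁻¹)
  have hint := integrable_kernel_mul hstrip
  have hadd := hK.add hK.conj hint fun x u => by
    refine u.integrable.bdd_mul (c := w ⌊x⌋)
      (Complex.continuous_conj.measurable.comp (hstrip.measurable x)).aestronglyMeasurable
      (Eventually.of_forall fun y => ?_)
    rw [RCLike.norm_conj]
    exact hstrip.bound x y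
  refine exists_sVal_le_of_stripKernel (K := stripKernel fun p =>
    ((2 * (2 * Real.pi)⁻¹ * (halfFourier b φ p).re : ℝ) : ℂ)) ?_ hC hstrip' (by positivity)
  convert hadd using 1
  funext x y
  rw [Complex.add_conj, stripKernel, stripKernel]
  split_ifs
  · rw [Complex.re_ofReal_mul]
    push_cast
    ring
  · simp

theorem eigPlus_comparison {A E B : L2R →L[ℂ] L2R} {C : ℝ} (hC : ∀ k : ℕ, sVal E k ≤ C / (k + 1))
    (hAB : A = conjL2.comp (B.comp conjL2) + E) (j k : ℕ) :
    eigPlus A (j + k) ≤ eigPlus B j + C / ((k : ℝ) + 1) := by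
  rw [hAB]
  refine (eigPlus_add_le not_finiteDimensional_L2R _ _ j k).trans (add_le_add ?_ ?_)
  · exact eigPlus_conj_le not_finiteDimensional_L2R conjL2 conjL2_conjL2 inner_conjL2 B j
  · exact (eigPlus_le_sVal not_finiteDimensional_L2R E k).trans (hC k)

end SpectralSymmetry

/-- **Proposition (spectral symmetry).** For the quarter plane `Ω = Ω_{π/2}` and real-valued
`φ ∈ C_0^∞(ℝ²)`, the operator `A_Ω = A_Ω[φ]` satisfies
`G^{(±)}_{1,1}(A_Ω) = ½ G_{1,1}(A_Ω)` and `g^{(±)}_{1,1}(A_Ω) = ½ g_{1,1}(A_Ω)`. -/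
theorem quarter_plane_spectral_symmetry
    (φ : ℝ × ℝ → ℝ) (hφ_smooth : ContDiff ℝ (⊤ : ℕ∞) φ) (hφ_supp : HasCompactSupport φ)
    (T : L2R →L[ℂ] L2R) (hT : IsWeylOp (symbAOm (sector (Real.pi / 2)) φ) T) :
    GfunPlus 1 1 T = GfunMinus 1 1 T ∧ GfunPlus 1 1 T = (1 / 2) * Gfun 1 1 T ∧
    gfunPlus 1 1 T = gfunMinus 1 1 T ∧ gfunPlus 1 1 T = (1 / 2) * gfun 1 1 T := by
  obtain ⟨b, hb, hsub⟩ := hφ_supp.isCompact.isBounded.subset_ball_lt 0 0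
  have h : IsBump b φ := ⟨hφ_smooth, hsub⟩
  have hE := not_finiteDimensional_L2R
  have hsym := isSymmetric_of_isWeylOp h hb.le hT
  have hA := exists_sVal_lt_of_isWeylOp h hb.le hT
  obtain ⟨C, hC, hCk⟩ := exists_sVal_add_conj_le h hb.le hT
  have hmain := weighted_limits_eq (a := eigPlus T) (b := eigPlus (-T)) (s := sVal T) hC
    (fun k => eigPlus_nonneg hE hA k)
    (fun k => eigPlus_nonneg hE (fun ε hε => by simpa only [sVal_neg] using hA ε hε) k)
    (sVal_nonneg T) (sVal_antitone T) (eigPlus_antitone hE T)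
    (eigPlus_comparison hCk ?_)
    (eigPlus_comparison (E := -(T + conjL2.comp (T.comp conjL2)))
      (fun k => by simpa only [sVal_neg] using hCk k) ?_)
    (sVal_two_mul_le_max hE hsym hA) (min_le_sVal_two_mul_add_one hE hsym hA)
  · simpa only [GfunPlus, GfunMinus, Gfun, gfunPlus, gfunMinus, gfun, fSigma_eq_weight] using hmain
  · ext1 f
    simp
  · ext1 f
    simp

end
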